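/- arXiv:math/0309155 — 4 statements merged into one kernel-verified Lean document; each statement's English description precedes it below -/
import Mathlib

section
/- Let R be a commutative ring, M an R-module, and R' a faithfully flat commutative R-algebra. If the R'-module R' ⊗_R M is projective, then M is a projective R-module. -/
open TensorProduct

namespace FFDescent

section A
variable {R : Type*} [CommRing R] (R' : Type*) [CommRing R'] [Algebra R R']
  {C : Type*} [AddCommGroup C] [Module R C]

/-- An element of such a tensor product is determined by its coordinates. -/
lemma pi_tensor_ext {n : ℕ} (z w : (Fin n → R') ⊗[R] C)
    (h : ∀ k, (LinearMap.proj (R := R) (φ := fun _ : Fin n => R') k).rTensor C z =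
      (LinearMap.proj (R := R) (φ := fun _ : Fin n => R') k).rTensor C w) : z = w := by
  have key : ∀ z : (Fin n → R') ⊗[R] C, z = ∑ k, (LinearMap.single R (fun _ : Fin n => R') k).rTensor C
      ((LinearMap.proj (R := R) (φ := fun _ : Fin n => R') k).rTensor C z) := by
    intro z
    induction z with
    | zero => simp
    | add x y hx hy =>
      simp only [map_add, Finset.sum_add_distrib]
      rw [← hx, ← hy]
    | tmul a c =>
      simp only [LinearMap.rTensor_tmul, ← TensorProduct.sum_tmul]
      congr 1
      ext i
      simp [Finset.sum_apply, Pi.single_apply]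
  rw [key z, key w]
  simp only [h]

/-- The submodule of vectors `(φ (1 ⊗ c k))_k`. -/
noncomputable def contr {n : ℕ} (c : Fin n → C) :
    (R' ⊗[R] C →ₗ[R'] R') →ₗ[R'] (Fin n → R') :=
  LinearMap.pi fun k => LinearMap.applyₗ (1 ⊗ₜ[R] c k)

lemma exists_contr [Module.Flat R C] [Module.Projective R' (R' ⊗[R] C)] {n : ℕ} (c : Fin n → C) :
    ∃ (m : ℕ) (A : Fin n → Fin m → R) (d : Fin m → C), (∀ k, c k = ∑ j, A k j • d j) ∧
      ∀ j, ∃ φ : R' ⊗[R] C →ₗ[R'] R', ∀ k, algebraMap R R' (A k j) = φ (1 ⊗ₜ[R] c k) := by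
  classical
  obtain ⟨s, hs⟩ := (Module.projective_def' (R := R') (P := R' ⊗[R] C)).1 inferInstance
  set I := (LinearMap.range (contr (R := R) R' c)).restrictScalars R with hI
  let T : Finset (R' ⊗[R] C) := Finset.univ.biUnion fun k => (s (1 ⊗ₜ[R] c k)).support
  let a : R' ⊗[R] C → I := fun e => ⟨contr (R := R) R' c (Finsupp.lapply e ∘ₗ s), ⟨_, rfl⟩⟩
  let μ : R' ⊗[R] C → (R' →ₗ[R] I) := fun e =>
    { toFun := fun r => ⟨r • (a e : Fin n → R'), by
        exact Submodule.smul_mem (LinearMap.range (contr (R := R) R' c)) _ (a e).2⟩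
      map_add' := by intro x y; ext; simp [add_mul]
      map_smul' := by intro x y; ext; simp }
  let y : I ⊗[R] C := ∑ e ∈ T, (μ e).rTensor C e
  have hy : I.subtype.rTensor C y = ∑ k, (Pi.single k 1 : Fin n → R') ⊗ₜ[R] c k := by
    apply pi_tensor_ext
    intro k
    have h1 : ∀ e z, (LinearMap.proj (R := R) (φ := fun _ : Fin n => R') k).rTensor C
        (I.subtype.rTensor C ((μ e).rTensor C z)) = (s (1 ⊗ₜ[R] c k) e) • z := by
      intro e z
      induction z with
      | zero => simp
      | add x y hx hy => simp only [map_add, smul_add, hx, hy]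
      | tmul r x =>
        simp only [LinearMap.rTensor_tmul, TensorProduct.smul_tmul']
        congr 1
        simp [μ, a, contr, mul_comm]
    have h2 : ∑ e ∈ T, (s (1 ⊗ₜ[R] c k) e) • e = (1 ⊗ₜ[R] c k : R' ⊗[R] C) := by
      have := LinearMap.congr_fun hs (1 ⊗ₜ[R] c k)
      rw [LinearMap.comp_apply, Finsupp.linearCombination_apply, LinearMap.id_apply] at this
      conv_rhs => rw [← this]
      rw [Finsupp.sum]
      symm
      apply Finset.sum_subset
      · intro e he
        exact Finset.mem_biUnion.2 ⟨k, Finset.mem_univ _, he⟩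
      · intro e _ he
        simp [Finsupp.notMem_support_iff.1 he]
    simp only [y, map_sum, h1, h2]
    simp only [LinearMap.rTensor_tmul, LinearMap.proj_apply]
    rw [Finset.sum_eq_single k]
    · simp
    · intro b _ hb
      simp [hb.symm]
    · simp
  obtain ⟨S, hS⟩ := TensorProduct.exists_finset y
  have hrel : ∑ i : Fin n ⊕ S, (Sum.elim (fun k => (Pi.single k 1 : Fin n → R'))
      (fun p => -((p.1.1 : I) : Fin n → R')) i) ⊗ₜ[R] (Sum.elim c (fun p => p.1.2) i) = 0 := by
    rw [Fintype.sum_sum_type]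
    simp only [Sum.elim_inl, Sum.elim_inr]
    rw [← hy, hS, map_sum, ← Finset.sum_coe_sort S]
    simp [TensorProduct.neg_tmul]
  obtain ⟨m, b, d, hb, hz⟩ := vanishesTrivially_of_sum_tmul_eq_zero_of_rTensor_injective R
    (Module.Flat.rTensor_preserves_injective_linearMap _ (Submodule.injective_subtype _)) hrel
  refine ⟨m, fun k => b (Sum.inl k), d, fun k => hb (Sum.inl k), fun j => ?_⟩
  have hj := hz j
  rw [Fintype.sum_sum_type] at hj
  simp only [Sum.elim_inl, Sum.elim_inr, smul_neg, Finset.sum_neg_distrib] at hj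
  rw [add_neg_eq_zero] at hj
  have hmem : ∑ p : S, b (Sum.inr p) j • ((p.1.1 : I) : Fin n → R') ∈ I :=
    Submodule.sum_mem _ fun p _ => Submodule.smul_mem _ _ p.1.1.2
  rw [← hj] at hmem
  obtain ⟨φ, hφ⟩ := hmem
  refine ⟨φ, fun k => ?_⟩
  have := congr_fun hφ k
  simp only [contr, LinearMap.pi_apply, LinearMap.applyₗ_apply_apply] at this
  rw [this]
  simp [Finset.sum_apply, Pi.single_apply, Algebra.algebraMap_eq_smul_one]

lemma descend_span [Module.FaithfullyFlat R R'] {n m : ℕ} (a : Fin n → R) (g : Fin n → Fin m → R)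
    (t : Fin m → R') (h : ∀ k, algebraMap R R' (a k) = ∑ i, algebraMap R R' (g k i) * t i) :
    ∃ s : Fin m → R, ∀ k, a k = ∑ i, g k i * s i := by
  classical
  let G : Submodule R (Fin n → R) := Submodule.span R (Set.range fun i k => g k i)
  have ha : a ∈ G := by
    rw [← Submodule.Quotient.mk_eq_zero]
    apply Module.FaithfullyFlat.tensorProduct_mk_injective (A := R) (B := R')
    rw [map_zero, TensorProduct.mk_apply]
    have h1 : (1 : R') ⊗ₜ[R] a = ∑ i, t i ⊗ₜ[R] (fun k => g k i) := by
      apply (TensorProduct.piScalarRight R R' R' (Fin n)).injective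
      ext k
      simp [Finset.sum_apply, Algebra.smul_def, ← h] 
    have h2 := congr_arg (G.mkQ.lTensor R') h1
    simp only [LinearMap.lTensor_tmul, map_sum] at h2
    rw [Submodule.mkQ_apply] at h2
    rw [h2]
    apply Finset.sum_eq_zero
    intro i _
    rw [show G.mkQ (fun k => g k i) = 0 from
      (Submodule.Quotient.mk_eq_zero G).2 (Submodule.subset_span ⟨i, rfl⟩), TensorProduct.tmul_zero]
  obtain ⟨s, hs⟩ := (Submodule.mem_span_range_iff_exists_fun R).1 ha
  refine ⟨s, fun k => ?_⟩
  rw [← hs]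
  simp [Finset.sum_apply, mul_comm]

/-- `v` is a stabilising factorisation of `w`. -/
lemma exists_stable [Module.FaithfullyFlat R R'] [Module.Projective R' (R' ⊗[R] C)] {n : ℕ}
    (w : (Fin n → R) →ₗ[R] C) (x : C) :
    ∃ (m : ℕ) (v : (Fin n → R) →ₗ[R] (Fin m → R)) (w' : (Fin m → R) →ₗ[R] C),
      w' ∘ₗ v = w ∧ x ∈ LinearMap.range w' ∧
      ∀ (p : ℕ) (g : (Fin n → R) →ₗ[R] (Fin p → R)) (u : (Fin p → R) →ₗ[R] C), u ∘ₗ g = w →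
        ∃ h : (Fin p → R) →ₗ[R] (Fin m → R), h ∘ₗ g = v := by
  classical
  have : Module.Flat R C := Module.Flat.of_flat_tensorProduct R C R'
  obtain ⟨m, A, d, hc, hφ⟩ := exists_contr (R := R) R' (fun k => w (Pi.single k 1))
  let B : Fin n → Fin (m + 1) → R := fun k => Fin.snoc (α := fun _ => R) (A k) 0
  let d' : Fin (m + 1) → C := Fin.snoc (α := fun _ => C) d x
  refine ⟨m + 1, Fintype.linearCombination R B, Fintype.linearCombination R d', ?_, ?_, ?_⟩
  · ext k
    simp [Fintype.linearCombination_apply, hc k, Fin.sum_univ_castSucc, B, d', Pi.single_apply]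
  · refine ⟨Pi.single (Fin.last m) 1, ?_⟩
    simp [d']
  · intro p g u hu
    have hex : ∀ j : Fin (m + 1), ∃ s : Fin p → R, ∀ k, B k j = ∑ i, g (Pi.single k 1) i * s i := by
      intro j
      refine Fin.lastCases ?_ (fun j => ?_) j
      · exact ⟨0, by simp [B]⟩
      · obtain ⟨φ, h⟩ := hφ j
        apply descend_span R' (fun k => B k j.castSucc) (fun k i => g (Pi.single k 1) i)
          (fun i => φ (1 ⊗ₜ[R] u (Pi.single i 1)))
        intro k
        have h1 : w (Pi.single k 1) = ∑ i, g (Pi.single k 1) i • u (Pi.single i 1) := by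
          rw [← hu, LinearMap.comp_apply]
          conv_lhs => rw [pi_eq_sum_univ' (g (Pi.single k 1))]
          rw [map_sum]
          refine Finset.sum_congr rfl fun i _ => ?_
          rw [map_smul]
        simp only [B, Fin.snoc_castSucc]
        rw [h k, h1, TensorProduct.tmul_sum, map_sum]
        refine Finset.sum_congr rfl fun i _ => ?_
        rw [TensorProduct.tmul_smul, ← algebraMap_smul R', map_smul, smul_eq_mul]
    choose s hs using hex
    refine ⟨LinearMap.pi fun j => Fintype.linearCombination R (s j), ?_⟩
    ext k j
    have h1 : Fintype.linearCombination R B (Pi.single k 1) = B k := by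
      rw [Fintype.linearCombination_apply_single, one_smul]
    simp only [LinearMap.comp_apply, LinearMap.single_apply, h1, hs]
    simp [Fintype.linearCombination_apply]

lemma projective_of_seq [Module.Flat R C] (x : ℕ → C) (hx : Submodule.span R (Set.range x) = ⊤)
    (k : ℕ → ℕ) (W : ∀ n, (Fin (k n) → R) →ₗ[R] C)
    (V : ∀ n, (Fin (k n) → R) →ₗ[R] (Fin (k (n + 1)) → R))
    (hWV : ∀ n, W (n + 1) ∘ₗ V n = W n) (hxW : ∀ n, x n ∈ LinearMap.range (W (n + 1)))
    (hst : ∀ (n p : ℕ) (g : (Fin (k n) → R) →ₗ[R] (Fin p → R)) (u : (Fin p → R) →ₗ[R] C),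
      u ∘ₗ g = W n → ∃ h : (Fin p → R) →ₗ[R] (Fin (k (n + 1)) → R), h ∘ₗ g = V n) :
    Module.Projective R C := by
  classical
  set π : (C →₀ R) →ₗ[R] C := Finsupp.linearCombination R id with hπ
  have hπs : Function.Surjective π := Finsupp.linearCombination_id_surjective R C
  have step : ∀ n (ρ : {ρ : (Fin (k (n + 1)) → R) →ₗ[R] (C →₀ R) // π ∘ₗ ρ = W (n + 1)}),
      ∃ ρ' : {ρ : (Fin (k (n + 1 + 1)) → R) →ₗ[R] (C →₀ R) // π ∘ₗ ρ = W (n + 1 + 1)},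
        ρ'.1 ∘ₗ V (n + 1) ∘ₗ V n = ρ.1 ∘ₗ V n := by
    rintro n ⟨ρ, hρ⟩
    obtain ⟨τ, hτ⟩ := Module.projective_lifting_property π (W (n + 1 + 1)) hπs
    obtain ⟨h, hh⟩ := hst n _ (V (n + 1) ∘ₗ V n) (W (n + 1 + 1)) (by
      rw [← LinearMap.comp_assoc, hWV, hWV])
    refine ⟨⟨τ + (ρ - τ ∘ₗ V (n + 1)) ∘ₗ h, ?_⟩, ?_⟩
    · rw [LinearMap.comp_add, ← LinearMap.comp_assoc, LinearMap.comp_sub, hρ, ← LinearMap.comp_assoc,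
        hτ, hWV, sub_self, LinearMap.zero_comp, add_zero]
    · dsimp only
      rw [LinearMap.add_comp, LinearMap.comp_assoc (V (n + 1) ∘ₗ V n) h, hh, LinearMap.sub_comp,
        LinearMap.comp_assoc]
      exact add_sub_cancel (τ ∘ₗ V (n + 1) ∘ₗ V n) (ρ ∘ₗ V n)
  choose nxt hnxt using step
  obtain ⟨τ0, hτ0⟩ := Module.projective_lifting_property π (W (0 + 1)) hπs
  let ρ : ∀ n, {ρ : (Fin (k (n + 1)) → R) →ₗ[R] (C →₀ R) // π ∘ₗ ρ = W (n + 1)} := fun n =>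
    Nat.rec ⟨τ0, hτ0⟩ (fun n r => nxt n r) n
  have hρ : ∀ n, (ρ (n + 1)).1 ∘ₗ V (n + 1) ∘ₗ V n = (ρ n).1 ∘ₗ V n := fun n => hnxt n (ρ n)
  let σ : ∀ n, (Fin (k n) → R) →ₗ[R] (C →₀ R) := fun n => (ρ n).1 ∘ₗ V n
  have hσ : ∀ n, σ (n + 1) ∘ₗ V n = σ n := fun n => by
    simp only [σ]; rw [LinearMap.comp_assoc, hρ]
  have hπσ : ∀ n, π ∘ₗ σ n = W n := fun n => by
    simp only [σ]; rw [← LinearMap.comp_assoc, (ρ n).2, hWV]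
  have hker : ∀ n f, W n f = 0 → σ n f = 0 := by
    intro n f hf
    obtain ⟨p, a, y, h1, h2⟩ := Module.Flat.exists_factorization_of_apply_eq_zero_of_free hf
    let E : (Fin p →₀ R) ≃ₗ[R] (Fin p → R) := Finsupp.linearEquivFunOnFinite R R (Fin p)
    obtain ⟨h, hh⟩ := hst n p (E.toLinearMap ∘ₗ a) (y ∘ₗ E.symm.toLinearMap) (by
      rw [h1]; ext; simp)
    have : V n f = 0 := by
      rw [← hh]; simp [h2]
    simp [σ, this]
  have htrans : ∀ n j (f : Fin (k n) → R), ∃ f' : Fin (k (n + j)) → R,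
      W (n + j) f' = W n f ∧ σ (n + j) f' = σ n f := by
    intro n j f
    induction j with
    | zero => exact ⟨f, rfl, rfl⟩
    | succ j ih =>
      obtain ⟨f', h1, h2⟩ := ih
      refine ⟨V (n + j) f', ?_, ?_⟩
      · rw [← h1, ← hWV (n + j)]; rfl
      · rw [← h2, ← hσ (n + j)]; rfl
  have hle : ∀ n m, n ≤ m → ∀ f : Fin (k n) → R, ∃ f' : Fin (k m) → R,
      W m f' = W n f ∧ σ m f' = σ n f := by
    intro n m h f
    obtain ⟨j, rfl⟩ := Nat.exists_eq_add_of_le h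
    exact htrans n j f
  have hwd : ∀ n f m g, W n f = W m g → σ n f = σ m g := by
    intro n f m g h
    obtain ⟨f', h1, h2⟩ := hle n (max n m) (le_max_left _ _) f
    obtain ⟨g', h3, h4⟩ := hle m (max n m) (le_max_right _ _) g
    rw [← h2, ← h4, ← sub_eq_zero, ← map_sub]
    apply hker
    rw [map_sub, h1, h3, h, sub_self]
  have hadd : ∀ n f m g, ∃ p q, W p q = W n f + W m g ∧ σ p q = σ n f + σ m g := by
    intro n f m g
    obtain ⟨f', h1, h2⟩ := hle n (max n m) (le_max_left _ _) f
    obtain ⟨g', h3, h4⟩ := hle m (max n m) (le_max_right _ _) g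
    exact ⟨max n m, f' + g', by rw [map_add, h1, h3], by rw [map_add, h2, h4]⟩
  have hsurj : ∀ c, ∃ n f, W n f = c := by
    intro c
    have hc : c ∈ Submodule.span R (Set.range x) := hx ▸ Submodule.mem_top
    induction hc using Submodule.span_induction with
    | mem y hy =>
      obtain ⟨n, rfl⟩ := hy
      obtain ⟨f, hf⟩ := hxW n
      exact ⟨_, f, hf⟩
    | zero => exact ⟨0, 0, map_zero _⟩
    | add a b _ _ ha hb =>
      obtain ⟨n, f, rfl⟩ := ha
      obtain ⟨m, g, rfl⟩ := hb
      obtain ⟨p, q, h, _⟩ := hadd n f m g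
      exact ⟨p, q, h⟩
    | smul r a _ ha =>
      obtain ⟨n, f, rfl⟩ := ha
      exact ⟨n, r • f, map_smul _ _ _⟩
  choose N f hf using hsurj
  rw [Module.projective_def']
  refine ⟨{ toFun := fun c => σ (N c) (f c), map_add' := ?_, map_smul' := ?_ }, ?_⟩
  · intro a b
    obtain ⟨p, q, h, h'⟩ := hadd (N a) (f a) (N b) (f b)
    rw [← h']
    apply hwd
    rw [h, hf, hf, hf]
  · intro r a
    rw [RingHom.id_apply, ← map_smul]
    apply hwd
    rw [map_smul, hf, hf]
  · ext c
    have := LinearMap.congr_fun (hπσ (N c)) (f c)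
    rw [hf] at this
    exact this

theorem projective_of_countable [Module.FaithfullyFlat R R'] [Module.Projective R' (R' ⊗[R] C)]
    (x : ℕ → C) (hx : Submodule.span R (Set.range x) = ⊤) : Module.Projective R C := by
  have : Module.Flat R C := Module.Flat.of_flat_tensorProduct R C R'
  have H := fun (n : ℕ) (w : (Fin n → R) →ₗ[R] C) (x : C) => exists_stable R' w x
  choose m v w' h1 h2 h3 using H
  let st : ℕ → Σ k : ℕ, ((Fin k → R) →ₗ[R] C) := fun n =>
    Nat.rec ⟨0, 0⟩ (fun i p => ⟨m p.1 p.2 (x i), w' p.1 p.2 (x i)⟩) n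
  exact projective_of_seq x hx (fun n => (st n).1) (fun n => (st n).2)
    (fun n => v (st n).1 (st n).2 (x n)) (fun n => h1 (st n).1 (st n).2 (x n))
    (fun n => h2 (st n).1 (st n).2 (x n)) (fun n => h3 (st n).1 (st n).2 (x n))

end A
section Q

lemma quot_projective {S : Type*} [CommRing S] {ι N A W Q : Type*} [AddCommGroup N] [Module S N]
    [AddCommGroup A] [Module S A] [AddCommGroup W] [Module S W] [AddCommGroup Q] [Module S Q]
    (B : Module.Basis ι S N) (f : A →ₗ[S] W) (q : W →ₗ[S] Q) (hq : Function.Surjective q)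
    (hex : Function.Exact f q) (g : W →ₗ[S] N) (hg : Function.Injective g) (S1 S2 : Set ι)
    (h2 : LinearMap.range g = Submodule.span S (B '' S2))
    (h1 : LinearMap.range (g ∘ₗ f) = Submodule.span S (B '' S1)) : Module.Projective S Q := by
  classical
  let p : N →ₗ[S] N := B.constr S (fun i => if i ∈ S1 then 0 else B i)
  have hp0 : Submodule.span S (B '' S1) ≤ LinearMap.ker p := by
    rw [Submodule.span_le]
    rintro _ ⟨i, hi, rfl⟩
    simp [p, Module.Basis.constr_basis, hi]
  have hpk : LinearMap.ker q ≤ LinearMap.ker (p ∘ₗ g) := by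
    intro w hw
    obtain ⟨a, rfl⟩ := (hex w).1 hw
    have : g (f a) ∈ Submodule.span S (B '' S1) := h1 ▸ ⟨a, rfl⟩
    exact hp0 this
  let i : Q →ₗ[S] N := (LinearMap.ker q).liftQ (p ∘ₗ g) hpk ∘ₗ
    (q.quotKerEquivOfSurjective hq).symm.toLinearMap
  have hi : ∀ w, i (q w) = p (g w) := by
    intro w
    have : (q.quotKerEquivOfSurjective hq).symm (q w) = (LinearMap.ker q).mkQ w := by
      rw [LinearEquiv.symm_apply_eq]; rfl
    simp only [i, LinearMap.comp_apply, LinearEquiv.coe_coe, this]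
    rfl
  have hb : ∀ i, ∃ w, i ∈ S2 → g w = B i := by
    intro i
    by_cases hi : i ∈ S2
    · have : B i ∈ LinearMap.range g := h2 ▸ Submodule.subset_span ⟨i, hi, rfl⟩
      obtain ⟨w, hw⟩ := this
      exact ⟨w, fun _ => hw⟩
    · exact ⟨0, fun h => absurd h hi⟩
  choose b hb using hb
  have htop : Submodule.span S (b '' S2) = ⊤ := by
    apply Submodule.map_injective_of_injective hg
    rw [Submodule.map_span, Submodule.map_top, h2, ← Set.image_comp]
    congr 1
    exact Set.image_congr fun i hi => hb i hi
  let q' : N →ₗ[S] Q := B.constr S (fun i => q (b i))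
  have hqq : q' ∘ₗ p ∘ₗ g = q := by
    apply LinearMap.ext_on htop
    rintro _ ⟨i, hi, rfl⟩
    simp only [LinearMap.comp_apply, hb i hi]
    by_cases h : i ∈ S1
    · have : B i ∈ LinearMap.range (g ∘ₗ f) := h1 ▸ Submodule.subset_span ⟨i, h, rfl⟩
      obtain ⟨a, ha⟩ := this
      have : f a = b i := hg (by rw [hb i hi, ← ha]; rfl)
      rw [← this, (hex _).2 ⟨a, rfl⟩]
      simp [p, Module.Basis.constr_basis, h]
    · simp [p, q', Module.Basis.constr_basis, h]
  have : Module.Projective S N := Module.Projective.of_basis B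
  refine Module.Projective.of_split i q' ?_
  ext x
  obtain ⟨w, rfl⟩ := hq x
  rw [LinearMap.comp_apply, hi]
  exact LinearMap.congr_fun hqq w

end Q

section D
variable {R : Type*} [CommRing R] {R' : Type*} [CommRing R'] [Algebra R R']
  {M : Type*} [AddCommGroup M] [Module R M] {ι : Type*}

/-- Submodules whose base change is spanned by a part of the given basis. -/
def Good (B : Module.Basis ι R' (R' ⊗[R] M)) (K : Submodule R M) : Prop :=
  ∃ S : Set ι, K.baseChange R' = Submodule.span R' (B '' S)

lemma baseChange_le_iff (K : Submodule R M) (P : Submodule R' (R' ⊗[R] M)) :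
    K.baseChange R' ≤ P ↔ K ≤ (P.restrictScalars R).comap (TensorProduct.mk R R' M 1) := by
  rw [Submodule.baseChange_eq_span, Submodule.span_le]
  constructor
  · intro h x hx
    exact h ⟨x, hx, rfl⟩
  · rintro h _ ⟨x, hx, rfl⟩
    exact h hx

lemma Good.sSup {B : Module.Basis ι R' (R' ⊗[R] M)} (c : Set (Submodule R M))
    (h : ∀ K ∈ c, Good B K) : Good B (sSup c) := by
  choose! S hS using h
  refine ⟨⋃ K ∈ c, S K, le_antisymm ?_ ?_⟩
  · rw [baseChange_le_iff]
    refine sSup_le fun K hK => ?_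
    rw [← baseChange_le_iff, hS K hK]
    exact Submodule.span_mono (Set.image_mono (Set.subset_biUnion_of_mem hK))
  · rw [Submodule.span_le]
    rintro _ ⟨i, hi, rfl⟩
    simp only [Set.mem_iUnion] at hi
    obtain ⟨K, hK, hi⟩ := hi
    refine Submodule.baseChange_mono R' (le_sSup hK) ?_
    rw [hS K hK]
    exact Submodule.subset_span ⟨i, hi, rfl⟩

lemma exists_finite_gen (z : R' ⊗[R] M) : ∃ t : Set M, t.Finite ∧
    z ∈ Submodule.span R' (TensorProduct.mk R R' M 1 '' t) := by
  classical
  induction z with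
  | zero => exact ⟨∅, Set.finite_empty, Submodule.zero_mem _⟩
  | tmul r m =>
    refine ⟨{m}, Set.finite_singleton _, ?_⟩
    have : r ⊗ₜ[R] m = r • (TensorProduct.mk R R' M 1 m) := by
      simp [TensorProduct.smul_tmul']
    rw [this]
    exact Submodule.smul_mem _ _ (Submodule.subset_span ⟨m, rfl, rfl⟩)
  | add x y hx hy =>
    obtain ⟨s, hs, hxs⟩ := hx
    obtain ⟨t, ht, hyt⟩ := hy
    refine ⟨s ∪ t, hs.union ht, Submodule.add_mem _ ?_ ?_⟩
    · exact Submodule.span_mono (Set.image_mono Set.subset_union_left) hxs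
    · exact Submodule.span_mono (Set.image_mono Set.subset_union_right) hyt

lemma exists_good (B : Module.Basis ι R' (R' ⊗[R] M)) (x₀ : M) :
    ∃ x : ℕ → M, x₀ ∈ Set.range x ∧ Good B (Submodule.span R (Set.range x)) := by
  classical
  choose t ht hBt using fun i => exists_finite_gen (B i)
  let sp : M → Set ι := fun m => ((B.repr (1 ⊗ₜ[R] m)).support : Set ι)
  let nx : Set M → Set M := fun X => ⋃ m ∈ X, ⋃ i ∈ sp m, t i
  let X : ℕ → Set M := fun n => nx^[n] {x₀}
  have hXs : ∀ n, X (n + 1) = nx (X n) := fun n => Function.iterate_succ_apply' nx n _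
  have hXc : ∀ n, (X n).Countable := by
    intro n
    induction n with
    | zero => exact Set.countable_singleton x₀
    | succ n ih =>
      rw [hXs]
      exact ih.biUnion fun m _ => (Finset.countable_toSet _).biUnion fun i _ => (ht i).countable
  have hx₀ : x₀ ∈ ⋃ n, X n := Set.mem_iUnion.2 ⟨0, rfl⟩
  obtain ⟨x, hx⟩ := (Set.countable_iUnion hXc).exists_eq_range ⟨x₀, hx₀⟩
  refine ⟨x, hx ▸ hx₀, ⋃ m ∈ ⋃ n, X n, sp m, ?_⟩
  rw [← hx, Submodule.baseChange_span]
  apply le_antisymm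
  · rw [Submodule.span_le]
    rintro _ ⟨m, hm, rfl⟩
    have : (1 : R') ⊗ₜ[R] m ∈ Submodule.span R' (B '' sp m) := B.mem_span_repr_support _
    exact Submodule.span_mono (Set.image_mono (Set.subset_biUnion_of_mem hm)) this
  · rw [Submodule.span_le]
    rintro _ ⟨i, hi, rfl⟩
    simp only [Set.mem_iUnion] at hi
    obtain ⟨m, ⟨n, hn⟩, hi⟩ := hi
    refine Submodule.span_mono (Set.image_mono ?_) (hBt i)
    refine Set.Subset.trans ?_ (Set.subset_iUnion X (n + 1))
    rw [hXs]
    intro y hy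
    simp only [nx, Set.mem_iUnion]
    exact ⟨m, hn, i, hi, hy⟩

lemma quotient_projective [Module.FaithfullyFlat R R'] (B : Module.Basis ι R' (R' ⊗[R] M))
    {K K₂ : Submodule R M} (hK : Good B K) (hK₂ : Good B K₂) (x : ℕ → M)
    (hx : K₂ = K ⊔ Submodule.span R (Set.range x)) :
    Module.Projective R (K₂ ⧸ K.comap K₂.subtype) := by
  have hle : K ≤ K₂ := hx ▸ le_sup_left
  have hxK : ∀ n, x n ∈ K₂ := fun n => hx ▸ Submodule.mem_sup_right (Submodule.subset_span ⟨n, rfl⟩)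
  set q := (K.comap K₂.subtype).mkQ with hq
  have hqs : Function.Surjective q := Submodule.mkQ_surjective _
  have hex : Function.Exact (Submodule.inclusion hle) q := by
    intro y
    rw [hq, Submodule.mkQ_apply, Submodule.Quotient.mk_eq_zero]
    constructor
    · intro hy
      exact ⟨⟨y.1, hy⟩, rfl⟩
    · rintro ⟨z, rfl⟩
      exact z.2
  obtain ⟨S1, h1⟩ := hK
  obtain ⟨S2, h2⟩ := hK₂
  have hproj : Module.Projective R' (R' ⊗[R] (K₂ ⧸ K.comap K₂.subtype)) := by
    refine quot_projective B ((Submodule.inclusion hle).baseChange R') (q.baseChange R') ?_ ?_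
      (K₂.subtype.baseChange R') ?_ S1 S2 h2 ?_
    · exact LinearMap.lTensor_surjective R' hqs
    · exact lTensor_exact R' hex hqs
    · exact Module.Flat.lTensor_preserves_injective_linearMap K₂.subtype K₂.injective_subtype
    · rw [← LinearMap.baseChange_comp, ← h1]
      rfl
  refine projective_of_countable R' (fun n => q ⟨x n, hxK n⟩) ?_
  rw [eq_top_iff]
  rintro d -
  obtain ⟨k, rfl⟩ := hqs d
  set Y := Submodule.span R (Set.range fun n => q ⟨x n, hxK n⟩) with hY
  have : K₂ ≤ (Y.comap q).map K₂.subtype := by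
    conv_lhs => rw [hx]
    refine sup_le ?_ ?_
    · intro z hz
      refine ⟨⟨z, hle hz⟩, ?_, rfl⟩
      have : q ⟨z, hle hz⟩ = 0 := (hex _).2 ⟨⟨z, hz⟩, rfl⟩
      simp [this]
    · rw [Submodule.span_le]
      rintro _ ⟨n, rfl⟩
      exact ⟨⟨x n, hxK n⟩, Submodule.subset_span ⟨n, rfl⟩, rfl⟩
  obtain ⟨k', hk', hkk⟩ := this k.2
  have : k' = k := Subtype.ext hkk
  exact this ▸ hk'

theorem projective_of_basis [Module.FaithfullyFlat R R'] (B : Module.Basis ι R' (R' ⊗[R] M)) :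
    Module.Projective R M := by
  classical
  set π : (M →₀ R) →ₗ[R] M := Finsupp.linearCombination R id with hπ
  have hπs : Function.Surjective π := Finsupp.linearCombination_id_surjective R M
  let 𝒮 : Set (M →ₗ.[R] (M →₀ R)) := {f | Good B f.domain ∧ ∀ x : f.domain, π (f x) = x}
  obtain ⟨s, hs⟩ := zorn_le₀ 𝒮 (by
    intro c hc hch
    have hd : DirectedOn (· ≤ ·) c := hch.directedOn
    refine ⟨LinearPMap.sSup c hd, ⟨?_, ?_⟩, fun z hz => LinearPMap.le_sSup hd hz⟩
    · rw [LinearPMap.domain_sSup]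
      apply Good.sSup
      rintro _ ⟨f, hf, rfl⟩
      exact (hc hf).1
    · rintro ⟨x, hx⟩
      rcases c.eq_empty_or_nonempty with rfl | hne
      · have hx0 : x = 0 := by
          rw [LinearPMap.domain_sSup] at hx
          simpa using hx
        subst hx0
        have : (⟨0, hx⟩ : (LinearPMap.sSup ∅ hd).domain) = 0 := rfl
        rw [this, LinearPMap.map_zero, map_zero]
        rfl
      · obtain ⟨f, hf, hxf⟩ := (LinearPMap.mem_domain_sSup_iff hne hd).1 hx
        have := LinearPMap.sSup_apply hd hf ⟨x, hxf⟩
        exact (congr_arg π this).trans ((hc hf).2 ⟨x, hxf⟩))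
  have hdom : s.domain = ⊤ := by
    rw [eq_top_iff]
    rintro x₀ -
    obtain ⟨x, hx₀, hgx⟩ := exists_good B x₀
    set K := s.domain with hK
    obtain ⟨K₂, hK₂⟩ : ∃ K₂, K₂ = K ⊔ Submodule.span R (Set.range x) := ⟨_, rfl⟩
    have hle : K ≤ K₂ := hK₂ ▸ le_sup_left
    have hg₂ : Good B K₂ := by
      rw [hK₂, ← sSup_pair]
      apply Good.sSup
      rintro _ (rfl | rfl)
      · exact hs.prop.1
      · exact hgx
    have hP := quotient_projective B hs.prop.1 hg₂ x hK₂
    set q := (K.comap K₂.subtype).mkQ with hq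
    obtain ⟨σ, hσ⟩ := q.exists_rightInverse_of_surjective (Submodule.range_mkQ _)
    obtain ⟨τ, hτ⟩ := Module.projective_lifting_property π (K₂.subtype ∘ₗ σ) hπs
    have hmem : ∀ y : K₂, ((LinearMap.id - σ ∘ₗ q : K₂ →ₗ[R] K₂) y : M) ∈ K := by
      intro y
      have : q ((LinearMap.id - σ ∘ₗ q : K₂ →ₗ[R] K₂) y) = 0 := by
        have := LinearMap.congr_fun hσ (q y)
        simp only [LinearMap.comp_apply, LinearMap.id_apply] at this
        simp only [LinearMap.sub_apply, LinearMap.comp_apply, LinearMap.id_apply, map_sub, this,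
          sub_self]
      exact (Submodule.Quotient.mk_eq_zero (K.comap K₂.subtype)).1 this
    let r : K₂ →ₗ[R] K := LinearMap.codRestrict K
      (K₂.subtype ∘ₗ (LinearMap.id - σ ∘ₗ q : K₂ →ₗ[R] K₂)) hmem
    let s₂ : M →ₗ.[R] (M →₀ R) := ⟨K₂, s.toFun ∘ₗ r + τ ∘ₗ q⟩
    have hs₂ : s₂ ∈ 𝒮 := by
      refine ⟨hg₂, fun y => ?_⟩
      have e1 : π (s (r y)) = r y := hs.prop.2 (r y)
      have e2 : π (τ (q y)) = σ (q y) := LinearMap.congr_fun hτ (q y)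
      have e3 : s₂ y = s (r y) + τ (q y) := rfl
      have e4 : (r y : M) = y - σ (q y) := rfl
      rw [e3, map_add, e1, e2, e4, sub_add_cancel]
    have hss : s ≤ s₂ := by
      refine ⟨hle, fun y z hyz => ?_⟩
      have hz : q z = 0 := by
        refine (Submodule.Quotient.mk_eq_zero _).2 ?_
        change (z : M) ∈ K
        rw [← hyz]; exact y.2
      have e3 : s₂ z = s (r z) + τ (q z) := rfl
      have e4 : (r z : M) = z - σ (q z) := rfl
      have e5 : r z = y := by
        apply Subtype.ext
        rw [e4, hz, hyz]; simp
      rw [e3, e5, hz, map_zero, add_zero]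
    have := (hs.le_of_ge hs₂ hss).1
    apply this
    change x₀ ∈ K₂
    rw [hK₂]
    exact Submodule.mem_sup_right (Submodule.subset_span hx₀)
  rw [Module.projective_def']
  refine ⟨s.toFun ∘ₗ LinearMap.codRestrict s.domain LinearMap.id (fun y => hdom ▸ Submodule.mem_top), ?_⟩
  ext y
  exact hs.prop.2 ⟨y, _⟩

end D
section Swindle
variable (S : Type*) [CommRing S] (P Q : Type*) [AddCommGroup P] [Module S P]
  [AddCommGroup Q] [Module S Q]

/-- Eilenberg swindle. -/
noncomputable def swindle : (P × (ℕ →₀ P × Q)) ≃ₗ[S] (ℕ →₀ P × Q) :=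
  LinearEquiv.ofLinearMap
    (LinearMap.coprod (Finsupp.lsingle 0 ∘ₗ LinearMap.inl S P Q)
      (Finsupp.lsum S fun k : ℕ => LinearMap.coprod (Finsupp.lsingle (k + 1) ∘ₗ LinearMap.inl S P Q)
        (Finsupp.lsingle k ∘ₗ LinearMap.inr S P Q)))
    (Finsupp.lsum S fun k : ℕ => LinearMap.coprod
      (Nat.casesOn k (LinearMap.inl S P (ℕ →₀ P × Q))
        (fun j => LinearMap.inr S P (ℕ →₀ P × Q) ∘ₗ Finsupp.lsingle j ∘ₗ LinearMap.inl S P Q))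
      (LinearMap.inr S P (ℕ →₀ P × Q) ∘ₗ Finsupp.lsingle k ∘ₗ LinearMap.inr S P Q))
    (by
      apply Finsupp.lhom_ext'
      intro k
      apply LinearMap.prod_ext
      · cases k <;> ext1 p <;> simp [-Finsupp.coe_lsum, Finsupp.lsum_single, Prod.mk_zero_zero]
      · ext1 p; simp [-Finsupp.coe_lsum, Finsupp.lsum_single, Prod.mk_zero_zero])
    (by
      apply LinearMap.prod_ext
      · ext1 p; simp [-Finsupp.coe_lsum, Finsupp.lsum_single, Prod.mk_zero_zero]
      · apply Finsupp.lhom_ext'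
        intro k
        apply LinearMap.prod_ext
        · ext1 p; simp [-Finsupp.coe_lsum, Finsupp.lsum_single, Prod.mk_zero_zero]
        · ext1 p; simp [-Finsupp.coe_lsum, Finsupp.lsum_single, Prod.mk_zero_zero])

end Swindle

end FFDescent

/-- Raynaud–Gruson: faithfully flat descent of projectivity. -/
theorem projective_of_faithfullyFlat_tensor_projective
    (R : Type*) [CommRing R] (R' : Type*) [CommRing R'] [Algebra R R']
    [Module.FaithfullyFlat R R']
    (M : Type*) [AddCommGroup M] [Module R M]
    (h : Module.Projective R' (TensorProduct R R' M)) :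
    Module.Projective R M := by
  classical
  let P := TensorProduct R R' M
  obtain ⟨s, hs⟩ := (Module.projective_def' (R := R') (P := P)).1 h
  let p : (P →₀ R') →ₗ[R'] P := Finsupp.linearCombination R' id
  let Q := LinearMap.ker p
  have hps : ∀ y, p (s y) = y := fun y => LinearMap.congr_fun hs y
  -- the free module splits
  let e : (P →₀ R') ≃ₗ[R'] P × Q :=
    LinearEquiv.ofLinearMap
      (LinearMap.prod p (LinearMap.codRestrict Q (LinearMap.id - s ∘ₗ p) (fun y => by
        simp [Q, LinearMap.mem_ker, hps])))
      (LinearMap.coprod s Q.subtype)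
      (by
        apply LinearMap.ext
        rintro ⟨y, z⟩
        have hz : p z.1 = 0 := z.2
        apply Prod.ext
        · simp [hps, hz]
        · apply Subtype.ext
          simp [hps, hz])
      (by ext1 y; ext1; simp)
  let F := (ℕ × P) →₀ R
  let e1 : TensorProduct R R' F ≃ₗ[R'] ((ℕ × P) →₀ R') :=
    TensorProduct.finsuppScalarRight R R' R' (ℕ × P)
  let e2 : ((ℕ × P) →₀ R') ≃ₗ[R'] (ℕ →₀ P × Q) :=
    (Finsupp.curryLinearEquiv R').trans (Finsupp.mapRange.linearEquiv e)
  let E : TensorProduct R R' (M × F) ≃ₗ[R'] ((ℕ × P) →₀ R') :=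
    (TensorProduct.prodRight R R' R' M F).trans
      (((LinearEquiv.refl R' P).prodCongr (e1.trans e2)).trans
        ((FFDescent.swindle R' P Q).trans e2.symm))
  have hproj : Module.Projective R (M × F) :=
    FFDescent.projective_of_basis (R' := R') (Module.Basis.ofRepr E)
  exact Module.Projective.of_split (LinearMap.inl R M F) (LinearMap.fst R M F) (by ext; simp)
end

section
/- Every projective module (not necessarily finitely generated) over a local ring is free. -/
namespace KapLocal

lemma nonunit_mem_jacobson {R : Type*} [Ring R] [IsLocalRing R] {x : R} (hx : ¬ IsUnit x) :
    x ∈ (⊥ : Ideal R).jacobson := by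
  rw [Ideal.mem_jacobson_iff]
  intro y
  have h1 : ¬ IsUnit (y * x) := by
    rintro ⟨u, hu⟩
    have hz : (↑u⁻¹ * y) * x = 1 := by rw [mul_assoc, ← hu, Units.inv_mul]
    set z := (↑u⁻¹ * y : R) with hzdef
    rcases IsLocalRing.isUnit_or_isUnit_of_add_one (a := x * z) (b := 1 - x * z) (by abel) with h | h
    · obtain ⟨v, hv⟩ := h
      have hr : x * (z * ↑v⁻¹) = 1 := by rw [← mul_assoc, ← hv, Units.mul_inv]
      have : z = z * ↑v⁻¹ := left_inv_eq_right_inv hz hr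
      exact hx ⟨⟨x, z, by rw [this]; exact hr, hz⟩, rfl⟩
    · have h0 : (1 - x * z) * x = 0 := by rw [sub_mul, mul_assoc, hz]; simp
      have : x = 0 := (h.mul_right_eq_zero).1 h0
      rw [this, mul_zero] at hz
      exact zero_ne_one hz
  have h2 : IsUnit (y * x + 1) := by
    rcases IsLocalRing.isUnit_or_isUnit_of_add_one (a := - (y * x)) (b := y * x + 1) (by abel) with h | h
    · exact absurd ((IsUnit.neg_iff _).1 h) h1
    · exact h
  obtain ⟨u, hu⟩ := h2
  refine ⟨↑u⁻¹, ?_⟩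
  have : (↑u⁻¹ : R) * (y * x + 1) = 1 := by rw [← hu, Units.inv_mul]
  rw [mul_add, mul_one, ← mul_assoc] at this
  rw [this, sub_self]
  exact Ideal.zero_mem _

lemma exists_right_inv {A : Type*} [Ring A] (c : A) (h : c - 1 ∈ (⊥ : Ideal A).jacobson) :
    ∃ d, c * d = 1 := by
  obtain ⟨d, hd⟩ := Ideal.exists_mul_sub_mem_of_sub_one_mem_jacobson c h
  rw [Ideal.mem_bot, sub_eq_zero] at hd
  have h2 : d - 1 ∈ (⊥ : Ideal A).jacobson := by
    have : d - 1 = (-d) * (c - 1) := by rw [mul_sub, neg_mul, hd]; simp [sub_eq_add_neg, add_comm]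
    rw [this]
    exact Ideal.mul_mem_left _ _ h
  obtain ⟨e, he⟩ := Ideal.exists_mul_sub_mem_of_sub_one_mem_jacobson d h2
  rw [Ideal.mem_bot, sub_eq_zero] at he
  have : e = c := left_inv_eq_right_inv he hd
  exact ⟨d, this ▸ he⟩

lemma matrix_right_inv {R : Type*} [Ring R] [IsLocalRing R] {n : ℕ} (C : Matrix (Fin n) (Fin n) R)
    (h : ∀ i j, ¬ IsUnit ((C - 1) i j)) : ∃ D, C * D = 1 := by
  apply exists_right_inv
  have := Ideal.matrix_jacobson_le (n := Fin n) (⊥ : Ideal R)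
  rw [Ideal.matrix_bot] at this
  exact this fun i j => nonunit_mem_jacobson (h i j)

/-- `x` has an expression of length `n` through functionals. -/
def HasRep (R : Type*) [Ring R] {P : Type*} [AddCommGroup P] [Module R P] (x : P) (n : ℕ) : Prop :=
  ∃ (y : Fin n → P) (f : Fin n → (P →ₗ[R] R)), x = ∑ k, f k x • y k

lemma exists_hasRep {R : Type*} [Ring R] {P : Type*} [AddCommGroup P] [Module R P]
    [Module.Projective R P] (x : P) : ∃ n, HasRep R x n := by
  obtain ⟨s, hs⟩ := Module.projective_def.1 (inferInstance : Module.Projective R P)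
  let e := (s x).support.equivFin
  refine ⟨_, fun k => (e.symm k : P), fun k => Finsupp.lapply (e.symm k : P) ∘ₗ s, ?_⟩
  have h1 := hs x
  rw [Finsupp.linearCombination_apply, Finsupp.sum] at h1
  rw [← Finset.sum_coe_sort] at h1
  rw [← Equiv.sum_comp e]
  simpa using h1.symm

lemma exists_split {R : Type*} [Ring R] [IsLocalRing R] {P : Type*} [AddCommGroup P] [Module R P]
    [Module.Projective R P] (x : P) : ∃ (n : ℕ) (h : (Fin n → R) →ₗ[R] P)
      (g : P →ₗ[R] (Fin n → R)), (∀ v, g (h v) = v) ∧ x ∈ LinearMap.range h := by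
  classical
  have hex := exists_hasRep (R := R) x
  obtain ⟨y, f, hx⟩ := Nat.find_spec hex
  have hmin : ∀ m, HasRep R x m → Nat.find hex ≤ m := fun m hm => Nat.find_min' hex hm
  generalize Nat.find hex = n at y f hx hmin
  have key : ∀ (d : Fin n → R), ∑ k, f k x * d k = 0 → ∀ k, ¬ IsUnit (d k) := by
    intro d hd k hk
    obtain ⟨u, hu⟩ := hk
    cases n with
    | zero => exact k.elim0
    | succ m =>
      have : HasRep R x m := by
        refine ⟨fun j => y (k.succAbove j) - (d (k.succAbove j) * ↑u⁻¹) • y k,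
          fun j => f (k.succAbove j), ?_⟩
        have h1 : f k x = - ∑ j, f (k.succAbove j) x * (d (k.succAbove j) * ↑u⁻¹) := by
          rw [Fin.sum_univ_succAbove _ k] at hd
          have h2 : f k x * ↑u = - ∑ j, f (k.succAbove j) x * d (k.succAbove j) := by
            rw [hu]; exact eq_neg_of_add_eq_zero_left hd
          have h3 : f k x = (f k x * ↑u) * ↑u⁻¹ := by rw [mul_assoc, Units.mul_inv, mul_one]
          rw [h3, h2, neg_mul, Finset.sum_mul]
          simp only [mul_assoc]
        conv_lhs => rw [hx, Fin.sum_univ_succAbove _ k, h1]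
        simp only [smul_sub, Finset.sum_sub_distrib, neg_smul, Finset.sum_smul, mul_smul]
        abel
      have := hmin m this
      omega
  let C : Matrix (Fin n) (Fin n) R := Matrix.of fun k j => f j (y k)
  obtain ⟨D, hD⟩ := matrix_right_inv C (by
    intro i j
    refine key (fun k => (C - 1) k j) ?_ i
    have h1 : f j x = ∑ k, f k x * f j (y k) := by
      conv_lhs => rw [hx]
      simp
    simp only [Matrix.sub_apply, mul_sub, Finset.sum_sub_distrib, C, Matrix.of_apply, ← h1]
    simp [Matrix.one_apply])
  refine ⟨n, Fintype.linearCombination R y, Matrix.vecMulLinear D ∘ₗ LinearMap.pi f, ?_, ?_⟩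
  · intro v
    have : LinearMap.pi f (Fintype.linearCombination R y v) = Matrix.vecMul v C := by
      ext j
      simp [Fintype.linearCombination_apply, Matrix.vecMul, dotProduct, C]
    rw [LinearMap.comp_apply, this, Matrix.vecMulLinear_apply, Matrix.vecMul_vecMul, hD,
      Matrix.vecMul_one]
  · exact ⟨fun k => f k x, by rw [Fintype.linearCombination_apply]; exact hx.symm⟩

lemma exists_indep_compl {R : Type*} [Ring R] [IsLocalRing R] {P : Type*} [AddCommGroup P]
    [Module R P] [Module.Projective R P] (x : P) : ∃ (b : Set P) (K : Submodule R P),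
      LinearIndepOn R id b ∧ IsCompl (Submodule.span R b) K ∧ x ∈ Submodule.span R b := by
  obtain ⟨n, h, g, hgh, hx⟩ := exists_split (R := R) x
  have hinj : Function.Injective h := Function.LeftInverse.injective hgh
  have hspan : Submodule.span R (Set.range (h ∘ Pi.basisFun R (Fin n))) = LinearMap.range h := by
    rw [Set.range_comp, ← Submodule.map_span, (Pi.basisFun R (Fin n)).span_eq, Submodule.map_top]
  refine ⟨Set.range (h ∘ Pi.basisFun R (Fin n)), LinearMap.ker g, ?_, ?_, hspan ▸ hx⟩
  · apply LinearIndependent.linearIndepOn_id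
    exact (Pi.basisFun R (Fin n)).linearIndependent.map' h (LinearMap.ker_eq_bot.2 hinj)
  · rw [hspan]
    constructor
    · rw [Submodule.disjoint_def]
      rintro _ ⟨v, rfl⟩ hv
      rw [LinearMap.mem_ker, hgh] at hv
      simp [hv]
    · rw [codisjoint_iff, eq_top_iff]
      intro p _
      rw [Submodule.mem_sup]
      exact ⟨h (g p), ⟨_, rfl⟩, p - h (g p), by simp [hgh], by abel⟩

/-- Extending a linearly independent set spanning a direct summand. -/
lemma extend_step {R : Type*} [Ring R] [IsLocalRing R] {P : Type*} [AddCommGroup P]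
    [Module R P] [Module.Projective R P] (b : Set P) (hb : LinearIndepOn R id b)
    (K : Submodule R P) (hK : IsCompl (Submodule.span R b) K) (x : P) :
    ∃ (b' : Set P), b ⊆ b' ∧ LinearIndepOn R id b' ∧ (∃ K', IsCompl (Submodule.span R b') K') ∧
      x ∈ Submodule.span R b' := by
  have hx : x ∈ Submodule.span R b ⊔ K := by rw [hK.sup_eq_top]; trivial
  obtain ⟨s, hs, k, hk, rfl⟩ := Submodule.mem_sup.1 hx
  have : Module.Projective R K := 
    Module.Projective.of_split K.subtype (K.projectionOnto _ hK.symm) 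
      (by ext v; simp)
  obtain ⟨c, L, hc, hL, hkc⟩ := exists_indep_compl (R := R) (⟨k, hk⟩ : K)
  have hspc : Submodule.span R (K.subtype '' c) = (Submodule.span R c).map K.subtype :=
    (Submodule.map_span _ _).symm
  have hle : (Submodule.span R c).map K.subtype ≤ K := Submodule.map_subtype_le _ _
  refine ⟨b ∪ K.subtype '' c, Set.subset_union_left, ?_, ⟨L.map K.subtype, ?_⟩, ?_⟩
  · apply hb.id_union
    · exact (hc.map_injOn K.subtype (Submodule.injective_subtype K).injOn).id_image
    · rw [hspc]
      exact hK.disjoint.mono_right hle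
  · rw [Submodule.span_union, hspc]
    constructor
    · rw [Submodule.disjoint_def]
      rintro z hz ⟨l, hl, rfl⟩
      obtain ⟨a, ha, _, ⟨d, hd, rfl⟩, e⟩ := Submodule.mem_sup.1 hz
      have h1 : a ∈ K := by
        have : a = (l - d : K) := eq_sub_of_add_eq e
        rw [this]; exact Submodule.coe_mem _
      have h0 : a = 0 := (Submodule.disjoint_def.1 hK.disjoint) a ha h1
      rw [h0, zero_add] at e
      have : d = l := Subtype.ext e
      subst this
      simp [(Submodule.disjoint_def.1 hL.disjoint) d hd hl]
    · rw [codisjoint_iff, sup_assoc, ← Submodule.map_sup, hL.sup_eq_top, Submodule.map_top,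
        Submodule.range_subtype, hK.sup_eq_top]
  · rw [Submodule.span_union]
    refine add_mem (Submodule.mem_sup_left hs) (Submodule.mem_sup_right ?_)
    rw [hspc]
    exact ⟨⟨k, hk⟩, hkc, rfl⟩

/-- The countably generated case. -/
lemma countable_case {R : Type*} [Ring R] [IsLocalRing R] {P : Type*} [AddCommGroup P]
    [Module R P] [Module.Projective R P] (x : ℕ → P) (hx : Submodule.span R (Set.range x) = ⊤) :
    ∃ b : Set P, LinearIndepOn R id b ∧ Submodule.span R b = ⊤ := by
  let T := {b : Set P // LinearIndepOn R id b ∧ ∃ K, IsCompl (Submodule.span R b) K}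
  have step : ∀ (t : T) (p : P), ∃ t' : T, t.1 ⊆ t'.1 ∧ p ∈ Submodule.span R t'.1 := by
    rintro ⟨b, hb, K, hK⟩ p
    obtain ⟨b', h1, h2, h3, h4⟩ := extend_step b hb K hK p
    exact ⟨⟨b', h2, h3⟩, h1, h4⟩
  choose F hF1 hF2 using step
  let t0 : T := ⟨∅, linearIndepOn_empty _ _, ⊤, by simpa using isCompl_bot_top⟩
  let t : ℕ → T := fun n => Nat.rec t0 (fun n t => F t (x n)) n
  have hmono : Monotone fun n => (t n).1 := monotone_nat_of_le_succ fun n => hF1 (t n) (x n)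
  refine ⟨⋃ n, (t n).1, ?_, ?_⟩
  · exact linearIndepOn_iUnion_of_directed hmono.directed_le fun n => (t n).2.1
  · rw [eq_top_iff, ← hx, Submodule.span_le]
    rintro _ ⟨n, rfl⟩
    exact Submodule.span_mono (Set.subset_iUnion (fun n => (t n).1) (n+1)) (hF2 (t n) (x n))

section main
variable {R : Type*} [Ring R] {M : Type*} [AddCommGroup M] [Module R M]

/-- closed sets for a section `s` -/
def Closed (s : M →ₗ[R] (M →₀ R)) (S : Set M) : Prop := ∀ x ∈ S, ∀ y ∈ (s x).support, y ∈ S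

lemma exists_countable_closed (s : M →ₗ[R] (M →₀ R)) (x : M) :
    ∃ T : Set M, T.Countable ∧ x ∈ T ∧ Closed s T := by
  let T : ℕ → Set M := fun n => Nat.rec {x} (fun _ A => ⋃ y ∈ A, ((s y).support : Set M)) n
  refine ⟨⋃ n, T n, Set.countable_iUnion ?_, Set.mem_iUnion.2 ⟨0, rfl⟩, ?_⟩
  · intro n
    induction n with
    | zero => exact Set.countable_singleton x
    | succ n ih => exact ih.biUnion fun y _ => (Finset.countable_toSet _)
  · intro y hy z hz
    obtain ⟨n, hn⟩ := Set.mem_iUnion.1 hy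
    exact Set.mem_iUnion.2 ⟨n + 1, Set.mem_biUnion hn hz⟩

lemma exists_retract (s : M →ₗ[R] (M →₀ R))
    (hs : Function.LeftInverse (Finsupp.linearCombination R id) s) (S : Set M) (hS : Closed s S) :
    ∃ r : M →ₗ[R] M, (∀ m, r m ∈ Submodule.span R S) ∧ ∀ m ∈ Submodule.span R S, r m = m := by
  classical
  let r : M →ₗ[R] M := Finsupp.linearCombination R (fun x : S => (x : M)) ∘ₗ
    Finsupp.lsubtypeDomain S ∘ₗ s
  refine ⟨r, fun m => ?_, ?_⟩
  · have := Finsupp.range_linearCombination R (v := fun x : S => (x : M))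
    rw [Subtype.range_coe] at this
    rw [← this]
    exact ⟨_, rfl⟩
  · suffices h : Submodule.span R S ≤ LinearMap.eqLocus r LinearMap.id from fun m hm => h hm
    rw [Submodule.span_le]
    intro m hm
    change r m = m
    conv_rhs => rw [← hs m]
    have hsup : ((s m).support : Set M) ⊆ S := fun y hy => hS m hm y hy
    change Finsupp.linearCombination R (fun x : S => (x : M)) (Finsupp.subtypeDomain (· ∈ S) (s m)) = _
    rw [Finsupp.linearCombination_apply, Finsupp.linearCombination_apply]
    exact Finsupp.sum_subtypeDomain_index (h := fun a r => r • a) hsup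

end main

theorem main {R : Type*} [Ring R] [IsLocalRing R] {M : Type*} [AddCommGroup M] [Module R M]
    [Module.Projective R M] : Module.Free R M := by
  obtain ⟨s, hs⟩ := Module.projective_def.1 (inferInstance : Module.Projective R M)
  let Z : Set (Set M × Set M) := {q | Closed s q.1 ∧ LinearIndepOn R id q.2 ∧
    Submodule.span R q.2 = Submodule.span R q.1}
  obtain ⟨⟨S, B⟩, ⟨hS, hB, hspan⟩, hmax⟩ := zorn_le₀ Z (by
    intro c hc hchain
    refine ⟨(⋃ q ∈ c, q.1, ⋃ q ∈ c, q.2), ⟨?_, ?_, ?_⟩, ?_⟩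
    · intro x hx y hy
      obtain ⟨q, hq, hxq⟩ := Set.mem_iUnion₂.1 hx
      exact Set.mem_iUnion₂.2 ⟨q, hq, (hc hq).1 x hxq y hy⟩
    · apply linearIndepOn_biUnion_of_directed
      · intro a ha b hb
        obtain ⟨d, hd, h1, h2⟩ := hchain.directedOn a ha b hb
        exact ⟨d, hd, h1.2, h2.2⟩
      · exact fun q hq => (hc hq).2.1
    · simp only [Submodule.span_iUnion₂]
      exact iSup_congr fun q => iSup_congr fun hq => (hc hq).2.2
    · intro q hq
      exact ⟨Set.subset_biUnion_of_mem (u := fun q : Set M × Set M => q.1) hq,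
        Set.subset_biUnion_of_mem (u := fun q : Set M × Set M => q.2) hq⟩)
  have hall : ∀ x, x ∈ S := by
    intro x
    obtain ⟨T, hTc, hxT, hT⟩ := exists_countable_closed s x
    have hST : Closed s (S ∪ T) := by
      rintro z (hz | hz) y hy
      · exact Or.inl (hS z hz y hy)
      · exact Or.inr (hT z hz y hy)
    obtain ⟨r, hr1, hr2⟩ := exists_retract s hs S hS
    obtain ⟨r', hr1', hr2'⟩ := exists_retract s hs (S ∪ T) hST
    have hle : Submodule.span R S ≤ Submodule.span R (S ∪ T) :=
      Submodule.span_mono Set.subset_union_left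
    let Q : Submodule R M := LinearMap.ker r ⊓ Submodule.span R (S ∪ T)
    let π : M →ₗ[R] Q := LinearMap.codRestrict Q ((LinearMap.id - r) ∘ₗ r') (by
      intro m
      refine ⟨?_, ?_⟩
      · simp [hr2 _ (hr1 _)]
      · exact sub_mem (hr1' m) (hle (hr1 _)))
    have hπ : ∀ q : Q, π q = q := by
      intro q
      apply Subtype.ext
      have h1 : r q = 0 := q.2.1
      have h2 : r' q = q := hr2' _ q.2.2
      change r' q - r (r' q) = q
      rw [h2, h1, sub_zero]
    have : Module.Projective R Q := Module.Projective.of_split Q.subtype π (by ext q; simp [hπ])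
    obtain ⟨t, ht⟩ := hTc.exists_eq_range ⟨x, hxT⟩
    have hπS : ∀ m ∈ S, π m = 0 := by
      intro m hm
      have h1 := hr2 m (Submodule.subset_span hm)
      have h2 := hr2' m (hle (Submodule.subset_span hm))
      apply Subtype.ext
      change r' m - r (r' m) = 0
      rw [h2, h1, sub_self]
    obtain ⟨c, hc, hcs⟩ := countable_case (R := R) (P := Q) (fun n => π (t n)) (by
      rw [eq_top_iff]
      intro q _
      have : Submodule.span R (S ∪ T) ≤ (Submodule.span R (Set.range fun n => π (t n))).comap π := by
        rw [Submodule.span_le]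
        rintro z (hz | hz)
        · rw [SetLike.mem_coe, Submodule.mem_comap]
          rw [hπS z hz]; exact zero_mem _
        · rw [ht] at hz
          obtain ⟨n, rfl⟩ := hz
          exact Submodule.subset_span ⟨n, rfl⟩
      have := this q.2.2
      rwa [Submodule.mem_comap, hπ] at this)
    have hspc : Submodule.span R (Q.subtype '' c) = Q := by
      rw [← Submodule.map_span, hcs, Submodule.map_top, Submodule.range_subtype]
    have hmem : (S ∪ T, B ∪ Q.subtype '' c) ∈ Z := by
      refine ⟨hST, ?_, ?_⟩
      · apply hB.id_union
        · exact (hc.map_injOn Q.subtype (Submodule.injective_subtype Q).injOn).id_image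
        · rw [hspc, hspan, Submodule.disjoint_def]
          intro m hm hmQ
          rw [← hr2 m hm]; exact hmQ.1
      · change Submodule.span R (B ∪ Q.subtype '' c) = Submodule.span R (S ∪ T)
        rw [Submodule.span_union, hspc, hspan]
        apply le_antisymm
        · exact sup_le hle inf_le_right
        · intro m hm
          rw [Submodule.mem_sup]
          refine ⟨r m, hr1 m, m - r m, ⟨?_, sub_mem hm (hle (hr1 m))⟩, by abel⟩
          simp [hr2 _ (hr1 m)]
    have := hmax hmem ⟨Set.subset_union_left, Set.subset_union_left⟩
    exact this.1 (Or.inr hxT)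
  have htop : ⊤ ≤ Submodule.span R B := by
    change Submodule.span R B = Submodule.span R S at hspan
    rw [hspan]
    exact fun m _ => Submodule.subset_span (hall m)
  exact Module.Free.of_basis (Module.Basis.mk (v := fun b : B => (b : M)) hB (by simpa using htop))

end KapLocal

/-- Kaplansky: every projective module over a (not necessarily commutative)
local ring is free. -/
theorem projective_over_local_is_free
    (R : Type*) [Ring R] [IsLocalRing R]
    (M : Type*) [AddCommGroup M] [Module R M]
    (h : Module.Projective R M) : Module.Free R M := by
  exact KapLocal.main
end

section
/- Let R be a commutative Noetherian ring whose spectrum is connected, and let P be a projective R-module that is not finitely generated. Then P is free. -/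
namespace BassAux

/-- A split surjection decomposes its source. -/
theorem split_equiv {R A M : Type*} [CommRing R] [AddCommGroup A] [Module R A]
    [AddCommGroup M] [Module R M] (j : A →ₗ[R] M) (g : M →ₗ[R] A)
    (h : ∀ a, g (j a) = a) : Nonempty (M ≃ₗ[R] A × LinearMap.ker g) := by
  refine ⟨LinearEquiv.ofLinearMap
    (g.prod ((LinearMap.id - j ∘ₗ g).codRestrict (LinearMap.ker g) (by intro c; simp [h])))
    (j.coprod (LinearMap.ker g).subtype) ?_ ?_⟩
  · refine LinearMap.ext fun x => ?_
    obtain ⟨a, k, hk⟩ := x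
    have hk' : g k = 0 := hk
    refine Prod.ext ?_ (Subtype.ext ?_)
    · simp [h, hk']
    · simp [h, hk']
  · ext x
    simp

/-- Finitely supported functions into a product. -/
theorem finsupp_prod_equiv {R M N : Type*} [CommRing R] [AddCommGroup M] [Module R M]
    [AddCommGroup N] [Module R N] :
    Nonempty ((ℕ →₀ M × N) ≃ₗ[R] (ℕ →₀ M) × (ℕ →₀ N)) := by
  refine ⟨LinearEquiv.ofLinearMap
    ((Finsupp.mapRange.linearMap (LinearMap.fst R M N)).prod
      (Finsupp.mapRange.linearMap (LinearMap.snd R M N)))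
    ((Finsupp.mapRange.linearMap (LinearMap.inl R M N)).coprod
      (Finsupp.mapRange.linearMap (LinearMap.inr R M N))) ?_ ?_⟩
  · refine LinearMap.ext fun x => ?_
    obtain ⟨a, b⟩ := x
    refine Prod.ext ?_ ?_ <;> ext n <;> simp
  · refine LinearMap.ext fun x => ?_
    ext n <;> simp

/-- Eilenberg swindle. -/
theorem swindle {R Q Q' : Type*} [CommRing R] [AddCommGroup Q] [Module R Q]
    [AddCommGroup Q'] [Module R Q'] (e : (ℕ →₀ R) ≃ₗ[R] Q × Q') :
    Nonempty ((Q × (ℕ →₀ R)) ≃ₗ[R] (ℕ →₀ R)) := by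
  obtain ⟨d⟩ := finsupp_prod_equiv (R := R) (M := Q) (N := Q')
  let e1 : (ℕ →₀ R) ≃ₗ[R] (ℕ →₀ (ℕ →₀ R)) :=
    (Finsupp.domLCongr (Nat.pairEquiv.symm)).trans (Finsupp.curryLinearEquiv R)
  let e2 : (ℕ →₀ R) ≃ₗ[R] (ℕ →₀ Q) × (ℕ →₀ Q') :=
    (e1.trans (Finsupp.mapRange.linearEquiv e)).trans d
  let e3 : (Q × (ℕ →₀ Q)) ≃ₗ[R] (ℕ →₀ Q) :=
    (((Finsupp.uniqueLinearEquiv R Q ()).symm.prodCongr (LinearEquiv.refl R _)).trans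
      (Finsupp.sumFinsuppLEquivProdFinsupp R).symm).trans
      (Finsupp.domLCongr (((Equiv.sumComm _ _).trans
        ((Equiv.optionEquivSumPUnit ℕ).symm)).trans (Denumerable.eqv (Option ℕ))))
  exact ⟨(((LinearEquiv.refl R Q).prodCongr e2).trans
    (LinearEquiv.prodAssoc R _ _ _).symm).trans
      ((e3.prodCongr (LinearEquiv.refl R _)).trans e2.symm)⟩

/-- Countably generated projective modules are absorbed by `R^(ℕ)`. -/
theorem absorb {R Q : Type*} [CommRing R] [AddCommGroup Q] [Module R Q]
    [Module.Projective R Q] (u : ℕ → Q) (hu : Submodule.span R (Set.range u) = ⊤) :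
    Nonempty ((Q × (ℕ →₀ R)) ≃ₗ[R] (ℕ →₀ R)) := by
  have hs : Function.Surjective (Finsupp.linearCombination R u) := by
    rw [← LinearMap.range_eq_top, Finsupp.range_linearCombination, hu]
  obtain ⟨s, hs'⟩ := Module.projective_lifting_property _ (LinearMap.id (R := R) (M := Q)) hs
  obtain ⟨e⟩ := split_equiv s (Finsupp.linearCombination R u)
    (fun a => LinearMap.congr_fun hs' a)
  exact swindle (Q' := LinearMap.ker (Finsupp.linearCombination R u)) e

/-- In a Noetherian spectrum, sets stable both ways are closed. -/
theorem closed_of_stable {R : Type*} [CommRing R] [IsNoetherianRing R]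
    (Z : Set (PrimeSpectrum R))
    (hZ : ∀ p q : PrimeSpectrum R, p.asIdeal ≤ q.asIdeal → (p ∈ Z ↔ q ∈ Z)) : IsClosed Z := by
  have hfin : {p : PrimeSpectrum R | p.asIdeal ∈ minimalPrimes R ∧ p ∈ Z}.Finite := by
    refine Set.Finite.subset ((minimalPrimes.finite_of_isNoetherianRing R).preimage
      (f := PrimeSpectrum.asIdeal) (fun a _ b _ h => PrimeSpectrum.ext h)) ?_
    intro p hp
    exact hp.1
  have : Z = ⋃ p ∈ {p : PrimeSpectrum R | p.asIdeal ∈ minimalPrimes R ∧ p ∈ Z},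
      PrimeSpectrum.zeroLocus (p.asIdeal : Set R) := by
    ext q
    simp only [Set.mem_iUnion, PrimeSpectrum.mem_zeroLocus, SetLike.coe_subset_coe, exists_prop]
    constructor
    · intro hq
      obtain ⟨p, hp, hpq⟩ := Ideal.exists_minimalPrimes_le (I := (⊥ : Ideal R))
        (J := q.asIdeal) bot_le
      exact ⟨⟨p, hp.1.1⟩, ⟨hp, (hZ ⟨p, hp.1.1⟩ q hpq).2 hq⟩, hpq⟩
    · rintro ⟨p, ⟨_, hp⟩, hpq⟩
      exact (hZ p q hpq).1 hp
  rw [this]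
  exact hfin.isClosed_biUnion fun p _ => PrimeSpectrum.isClosed_zeroLocus _

section key

variable {R P I : Type*} [CommRing R] [IsNoetherianRing R] [AddCommGroup P] [Module R P]
  (i : P →ₗ[R] (I →₀ R)) (r : (I →₀ R) →ₗ[R] P)

/-- Dichotomy at a prime. -/
theorem fin_of_not_inf (hri : ∀ x, r (i x) = x) (q : Ideal R) (hq : q.IsPrime) (I0 : Finset I)
    (h : ∀ x : P, (∀ k ∈ I0, i x k = 0) → ∀ k, i x k ∈ q) :
    ∃ I1 : Finset I, ∀ x : P, (∀ k ∈ I1, i x k = 0) → ∃ s, s ∉ q ∧ s • x = 0 := by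
  classical
  let φ : P →ₗ[R] (I0 → R) := LinearMap.pi fun k => Finsupp.lapply (k : I) ∘ₗ i
  have hφ : ∀ x, φ x = 0 → ∀ k ∈ I0, i x k = 0 := fun x hx k hk => congr_fun hx ⟨k, hk⟩
  obtain ⟨t, ht⟩ : (LinearMap.range φ).FG := IsNoetherian.noetherian _
  have hpre : ∀ y : I0 → R, ∃ x : P, y ∈ t → φ x = y := by
    intro y
    by_cases hy : y ∈ t
    · have : y ∈ LinearMap.range φ := ht ▸ Submodule.subset_span hy
      obtain ⟨x, hx⟩ := this
      exact ⟨x, fun _ => hx⟩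
    · exact ⟨0, fun h => absurd h hy⟩
  choose c hc using hpre
  let N : Submodule R P := Submodule.span R ((t.image c : Finset P) : Set P)
  have hN : ∀ x : P, ∃ n ∈ N, φ (x - n) = 0 := by
    have hle : LinearMap.range φ ≤ N.map φ := by
      rw [← ht, Submodule.span_le]
      intro y hy
      exact ⟨c y, Submodule.subset_span (by simpa using ⟨y, hy, rfl⟩), hc y hy⟩
    intro x
    obtain ⟨n, hn, hn'⟩ := hle ⟨x, rfl⟩
    exact ⟨n, hn, by rw [map_sub, hn', sub_self]⟩
  let I1 : Finset I := t.biUnion fun y => (i (c y)).support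
  have hNI : ∀ n ∈ N, ∀ l, l ∉ I1 → i n l = 0 := by
    intro n hn l hl
    have : N ≤ LinearMap.ker (Finsupp.lapply l ∘ₗ i : P →ₗ[R] R) := by
      rw [Submodule.span_le]
      intro y hy
      simp only [Finset.coe_image, Set.mem_image, Finset.mem_coe] at hy
      obtain ⟨z, hz, rfl⟩ := hy
      simp only [SetLike.mem_coe, LinearMap.mem_ker, LinearMap.comp_apply, Finsupp.lapply_apply]
      by_contra hne
      exact hl (Finset.mem_biUnion.2 ⟨z, hz, Finsupp.mem_support_iff.2 hne⟩)
    exact this hn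
  have hE : ∀ k l, l ∉ I1 → i (r (Finsupp.single k 1)) l ∈ q := by
    intro k l hl
    obtain ⟨n, hn, hn'⟩ := hN (r (Finsupp.single k 1))
    have h1 := h _ (hφ _ hn') l
    rw [map_sub, Finsupp.sub_apply, hNI n hn l hl, sub_zero] at h1
    exact h1
  refine ⟨I1, fun x hx => ?_⟩
  let C : Ideal R := Ideal.span (Set.range (i x))
  have hC : C ≤ q • C := by
    rw [Ideal.span_le]
    rintro _ ⟨l, rfl⟩
    by_cases hl : l ∈ I1
    · rw [hx l hl]; exact Submodule.zero_mem _
    · have hsum : i x l = (i x).sum fun k a => a * i (r (Finsupp.single k 1)) l := by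
        have h1 : x = (i x).sum fun k a => a • r (Finsupp.single k 1) := by
          conv_lhs => rw [← hri x, ← Finsupp.sum_single (i x)]
          rw [map_finsuppSum]
          refine Finsupp.sum_congr fun k _ => ?_
          rw [← map_smul, Finsupp.smul_single, smul_eq_mul, mul_one]
        conv_lhs => rw [h1]
        rw [map_finsuppSum, Finsupp.sum, Finsupp.finsetSum_apply]
        refine Finset.sum_congr rfl fun k _ => ?_
        simp
      rw [SetLike.mem_coe, hsum]
      refine Submodule.sum_mem _ fun k _ => ?_
      change i x k * i (r (Finsupp.single k 1)) l ∈ q • C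
      rw [mul_comm]
      exact Submodule.smul_mem_smul (hE k l hl) (Ideal.subset_span ⟨k, rfl⟩)
  obtain ⟨s, hs, hs'⟩ := Submodule.exists_sub_one_mem_and_smul_eq_zero_of_fg_of_le_smul q C
    (IsNoetherian.noetherian _) hC
  refine ⟨s, fun hsq => hq.ne_top ((Ideal.eq_top_iff_one _).2 ?_), ?_⟩
  · simpa using q.sub_mem hsq hs
  · rw [← hri (s • x), map_smul]
    have : s • i x = 0 := by
      ext k
      exact hs' _ (Ideal.subset_span ⟨k, rfl⟩)
    rw [this, map_zero]

/-- Over a connected Noetherian ring, a non-f.g. projective is infinite at each prime. -/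
theorem inf_all [ConnectedSpace (PrimeSpectrum R)]
    (hri : ∀ x, r (i x) = x) (hinf : ¬ Module.Finite R P) (q : Ideal R) (hq : q.IsPrime)
    (I0 : Finset I) : ∃ x : P, (∀ k ∈ I0, i x k = 0) ∧ ∃ k, i x k ∉ q := by
  classical
  let Z : Set (PrimeSpectrum R) := {p | ∃ I1 : Finset I, ∀ x : P, (∀ k ∈ I1, i x k = 0) →
    ∃ s, s ∉ p.asIdeal ∧ s • x = 0}
  have hst : ∀ p q : PrimeSpectrum R, p.asIdeal ≤ q.asIdeal → (p ∈ Z ↔ q ∈ Z) := by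
    intro p q hpq
    constructor
    · rintro ⟨I1, h1⟩
      by_contra hqZ
      apply hqZ
      refine fin_of_not_inf i r hri q.asIdeal q.2 I1 fun x hx k => ?_
      obtain ⟨s, hs, hs'⟩ := h1 x hx
      have : s * i x k ∈ p.asIdeal := by
        have : s * i x k = i (s • x) k := by simp
        rw [this, hs']; simp
      exact hpq ((p.2.mem_or_mem this).resolve_left hs)
    · rintro ⟨I1, h1⟩
      refine ⟨I1, fun x hx => ?_⟩
      obtain ⟨s, hs, hs'⟩ := h1 x hx
      exact ⟨s, fun h => hs (hpq h), hs'⟩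
  have hcl : IsClopen Z := ⟨closed_of_stable Z hst,
    isClosed_compl_iff.1 (closed_of_stable Zᶜ fun p q hpq => not_congr (hst p q hpq))⟩
  rcases isClopen_iff.1 hcl with h | h
  · by_contra hcon
    push Not at hcon
    have : (⟨q, hq⟩ : PrimeSpectrum R) ∈ Z := fin_of_not_inf i r hri q hq I0 hcon
    rw [h] at this
    exact this
  · exfalso
    apply hinf
    have hfin := associatedPrimes.finite R R
    have hJ : ∀ p : Ideal R, ∃ J : Finset I, p.IsPrime → ∀ x : P, (∀ k ∈ J, i x k = 0) →
        ∃ s, s ∉ p ∧ s • x = 0 := by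
      intro p
      by_cases hp : p.IsPrime
      · have : (⟨p, hp⟩ : PrimeSpectrum R) ∈ Z := h ▸ Set.mem_univ _
        obtain ⟨J, hJ⟩ := this
        exact ⟨J, fun _ => hJ⟩
      · exact ⟨∅, fun h => absurd h hp⟩
    choose J hJ using hJ
    let I1 : Finset I := hfin.toFinset.biUnion J
    let φ : P →ₗ[R] (I1 → R) := LinearMap.pi fun k => Finsupp.lapply (k : I) ∘ₗ i
    refine Module.Finite.of_injective φ ((injective_iff_map_eq_zero φ).2 fun x hx => ?_)
    have hx' : ∀ k ∈ I1, i x k = 0 := fun k hk => congr_fun hx ⟨k, hk⟩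
    have : i x = 0 := by
      ext k
      by_contra hne
      obtain ⟨p, hp, hpk⟩ := exists_le_isAssociatedPrime_of_isNoetherianRing R (i x k) hne
      obtain ⟨s, hs, hs'⟩ := hJ p hp.isPrime x fun k hk =>
        hx' k (Finset.mem_biUnion.2 ⟨p, hfin.mem_toFinset.2 hp, hk⟩)
      apply hs
      apply hpk
      rw [Submodule.mem_colon_singleton]
      have : s • i x k = i (s • x) k := by simp
      rw [this, hs']; simp
    rw [← hri x, this, map_zero]

/-- Unimodular elements avoiding finitely many coordinates. -/
theorem exists_unimodular
    (H : ∀ q : Ideal R, q.IsPrime → ∀ I0 : Finset I,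
      ∃ x : P, (∀ k ∈ I0, i x k = 0) ∧ ∃ k, i x k ∉ q) (I0 : Finset I) :
    ∃ x : P, (∀ k ∈ I0, i x k = 0) ∧ Ideal.span (Set.range (i x)) = ⊤ := by
  classical
  let A : Set (Ideal R) := {C | ∃ x : P, (∀ k ∈ I0, i x k = 0) ∧ Ideal.span (Set.range (i x)) = C}
  have hA : A.Nonempty := ⟨_, 0, by simp, rfl⟩
  obtain ⟨C, ⟨x, hx, rfl⟩, hmax⟩ := set_has_maximal_iff_noetherian.2 ‹IsNoetherianRing R› A hA
  refine ⟨x, hx, ?_⟩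
  by_contra hne
  obtain ⟨m, hm, hle⟩ := Ideal.exists_le_maximal _ hne
  obtain ⟨z, hz, k, hk⟩ := H m hm.isPrime (I0 ∪ (i x).support)
  have hzx : ∀ l, i x l ≠ 0 → i z l = 0 := fun l hl =>
    hz l (Finset.mem_union_right _ (Finsupp.mem_support_iff.2 hl))
  refine hmax (Ideal.span (Set.range (i (x + z)))) ⟨x + z, fun l hl => ?_, rfl⟩
    (lt_of_le_of_ne ?_ ?_)
  · simp [hx l hl, hz l (Finset.mem_union_left _ hl)]
  · rw [Ideal.span_le]
    rintro _ ⟨l, rfl⟩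
    by_cases hl : i x l = 0
    · rw [hl]; exact Submodule.zero_mem _
    · refine Ideal.subset_span ⟨l, ?_⟩
      simp [hzx l hl]
  · intro heq
    have hxk : i x k = 0 := by
      by_contra h0
      exact hk (by rw [hzx k h0]; exact m.zero_mem)
    apply hk
    apply hle
    rw [heq]
    exact Ideal.subset_span ⟨k, by simp [hxk]⟩

/-- A split copy of `R^(ℕ)`. -/
theorem exists_split
    (H : ∀ I0 : Finset I, ∃ x : P, (∀ k ∈ I0, i x k = 0) ∧ Ideal.span (Set.range (i x)) = ⊤) :
    ∃ (j : (ℕ →₀ R) →ₗ[R] P) (g : P →ₗ[R] (ℕ →₀ R)), ∀ a, g (j a) = a := by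
  classical
  obtain ⟨z, hz, hd⟩ := exists_seq_of_forall_finset_exists
    (fun x : P => Ideal.span (Set.range (i x)) = ⊤)
    (fun x y : P => Disjoint (i x).support (i y).support) (by
      intro s _
      obtain ⟨y, hy, hy'⟩ := H (s.biUnion fun x => (i x).support)
      refine ⟨y, hy', fun x hx => Finset.disjoint_left.2 fun k hk hk' => ?_⟩
      exact (Finsupp.mem_support_iff.1 hk') (hy k (Finset.mem_biUnion.2 ⟨x, hx, hk⟩)))
  have hd' : ∀ m n k, k ∈ (i (z m)).support → k ∈ (i (z n)).support → m = n := by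
    intro m n k hm hn
    rcases lt_trichotomy m n with h | h | h
    · exact absurd hn (Finset.disjoint_left.1 (hd m n h) hm)
    · exact h
    · exact absurd hm (Finset.disjoint_left.1 (hd n m h) hn)
  have ha : ∀ n, ∃ a : I →₀ R, Finsupp.linearCombination R (i (z n)) a = 1 := by
    intro n
    have : (1 : R) ∈ Ideal.span (Set.range (i (z n))) := by rw [hz n]; trivial
    exact (Finsupp.mem_span_range_iff_exists_finsupp.1 this)
  choose a ha using ha
  let w : I → (ℕ →₀ R) := fun k =>
    if h : ∃ n, k ∈ (i (z n)).support then Finsupp.single h.choose (a h.choose k) else 0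
  have hw : ∀ n k, k ∈ (i (z n)).support → w k = Finsupp.single n (a n k) := by
    intro n k hk
    have h : ∃ n, k ∈ (i (z n)).support := ⟨n, hk⟩
    have hn : h.choose = n := hd' _ _ k h.choose_spec hk
    simp only [w]
    rw [dif_pos h, hn]
  have hwz : ∀ n, Finsupp.linearCombination R w (i (z n)) = Finsupp.single n 1 := by
    intro n
    rw [Finsupp.linearCombination_apply, Finsupp.sum]
    rw [Finset.sum_congr rfl (fun k hk => by rw [hw n k hk])]
    simp only [Finsupp.smul_single, smul_eq_mul]
    rw [← Finsupp.single_finsetSum]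
    congr 1
    rw [← ha n, Finsupp.linearCombination_apply, Finsupp.sum]
    simp only [smul_eq_mul]
    refine ((Finset.sum_subset (Finset.subset_union_left (s₂ := (a n).support)) ?_).trans
      (Finset.sum_congr rfl fun _ _ => mul_comm _ _)).trans
      (Finset.sum_subset (Finset.subset_union_right (s₁ := (i (z n)).support)) ?_).symm
    · intro k _ hk
      rw [Finsupp.notMem_support_iff.1 hk, zero_mul]
    · intro k _ hk
      rw [Finsupp.notMem_support_iff.1 hk, zero_mul]
  refine ⟨Finsupp.linearCombination R z, Finsupp.linearCombination R w ∘ₗ i, fun b => ?_⟩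
  have : (Finsupp.linearCombination R w ∘ₗ i) ∘ₗ Finsupp.linearCombination R z
      = LinearMap.id := by
    refine Finsupp.lhom_ext' fun n => LinearMap.ext_ring ?_
    simp [hwz]
  exact LinearMap.congr_fun this b

end key

/-- The countably generated case. -/
theorem free_of_countable {R P : Type*} [CommRing R] [IsNoetherianRing R]
    [ConnectedSpace (PrimeSpectrum R)] [AddCommGroup P] [Module R P]
    [Module.Projective R P] (hinf : ¬ Module.Finite R P)
    (u : ℕ → P) (hu : Submodule.span R (Set.range u) = ⊤) : Module.Free R P := by
  obtain ⟨s, hs⟩ := Module.projective_def'.1 ‹Module.Projective R P›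
  have hri : ∀ x, Finsupp.linearCombination R id (s x) = x := fun x => LinearMap.congr_fun hs x
  obtain ⟨j, g, hgj⟩ := exists_split s (exists_unimodular s
    (fun q hq I0 => inf_all s _ hri hinf q hq I0))
  obtain ⟨e⟩ := split_equiv j g hgj
  let pr : P →ₗ[R] LinearMap.ker g := LinearMap.snd R _ _ ∘ₗ e.toLinearMap
  let inc : LinearMap.ker g →ₗ[R] P := e.symm.toLinearMap ∘ₗ LinearMap.inr R _ _
  have hpr : pr ∘ₗ inc = LinearMap.id := by ext x; simp [pr, inc]
  have hsurj : Function.Surjective pr := fun y => ⟨inc y, LinearMap.congr_fun hpr y⟩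
  have : Module.Projective R (LinearMap.ker g) := Module.Projective.of_split inc pr hpr
  obtain ⟨d⟩ := absorb (R := R) (Q := LinearMap.ker g) (fun n => pr (u n)) (by
    have : Set.range (fun n => pr (u n)) = pr '' Set.range u := by
      rw [← Set.range_comp]; rfl
    rw [this, Submodule.span_image, hu, Submodule.map_top, LinearMap.range_eq_top.2 hsurj])
  exact Module.Free.of_equiv ((e.trans (LinearEquiv.prodComm R _ _)).trans d).symm

section big

variable {R P I : Type*} [CommRing R] [AddCommGroup P] [Module R P]
  (i : P →ₗ[R] (I →₀ R)) (r : (I →₀ R) →ₗ[R] P)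

/-- The part of `P` generated by the coordinates in `S`. -/
noncomputable def part (S : Set I) : Submodule R P := (Finsupp.supported R R S).map r

/-- `S` is closed under the idempotent. -/
def Good (S : Set I) : Prop := ∀ k ∈ S, i (r (Finsupp.single k 1)) ∈ Finsupp.supported R R S

theorem part_eq_span (S : Set I) :
    part r S = Submodule.span R ((fun k => r (Finsupp.single k 1)) '' S) := by
  rw [part, Finsupp.supported_eq_span_single, Submodule.map_span, Set.image_image]

theorem part_mono {S T : Set I} (h : S ⊆ T) : part r S ≤ part r T :=
  Submodule.map_mono (Finsupp.supported_mono h)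

theorem mem_part (hri : ∀ x, r (i x) = x) {S : Set I} {x : P}
    (h : ↑(i x).support ⊆ S) : x ∈ part r S :=
  ⟨i x, (Finsupp.mem_supported R _).2 h, hri x⟩

theorem Good.le {S : Set I} (h : Good i r S) :
    part r S ≤ (Finsupp.supported R R S).comap i := by
  rw [part_eq_span, Submodule.span_le]
  rintro _ ⟨k, hk, rfl⟩
  exact h k hk

theorem Good.retract (hri : ∀ x, r (i x) = x) {S : Set I} (h : Good i r S) :
    ∃ ρ : P →ₗ[R] P, (∀ x, ρ x ∈ part r S) ∧ ∀ x ∈ part r S, ρ x = x := by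
  classical
  refine ⟨r ∘ₗ (Finsupp.supported R R S).subtype ∘ₗ Finsupp.restrictDom R R S ∘ₗ i, ?_, ?_⟩
  · intro x
    exact ⟨_, (Finsupp.restrictDom R R S (i x)).2, rfl⟩
  · intro x hx
    have h1 : i x ∈ Finsupp.supported R R S := h.le i r hx
    have h2 := LinearMap.congr_fun (Finsupp.restrictDom_comp_subtype (R := R) (M := R) S) ⟨i x, h1⟩
    simp only [LinearMap.comp_apply, Submodule.subtype_apply, LinearMap.id_apply] at h2 ⊢
    rw [h2, hri]

theorem Good.sUnion {c : Set (Set I)} (h : ∀ S ∈ c, Good i r S) : Good i r (⋃₀ c) := by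
  rintro k ⟨S, hS, hk⟩
  exact Finsupp.supported_mono (Set.subset_sUnion_of_mem hS) (h S hS k hk)

theorem Good.union {S T : Set I} (hS : Good i r S) (hT : Good i r T) : Good i r (S ∪ T) := by
  rintro k (hk | hk)
  · exact Finsupp.supported_mono Set.subset_union_left (hS k hk)
  · exact Finsupp.supported_mono Set.subset_union_right (hT k hk)

theorem exists_good_countable (A : Set I) (hA : A.Countable) :
    ∃ C : Set I, A ⊆ C ∧ C.Countable ∧ Good i r C := by
  let f : Set I → Set I := fun B => ⋃ k ∈ B, ((i (r (Finsupp.single k 1))).support : Set I)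
  have hc : ∀ n, (f^[n] A).Countable := by
    intro n
    induction n with
    | zero => exact hA
    | succ n ih =>
      rw [Function.iterate_succ_apply']
      exact ih.biUnion fun k _ => Finset.countable_toSet _
  refine ⟨⋃ n, f^[n] A, Set.subset_iUnion (fun n => f^[n] A) 0, Set.countable_iUnion hc, ?_⟩
  intro k hk
  obtain ⟨n, hn⟩ := Set.mem_iUnion.1 hk
  rw [Finsupp.mem_supported]
  refine subset_trans ?_ (Set.subset_iUnion (fun n => f^[n] A) (n + 1))
  change _ ⊆ f^[n + 1] A
  rw [Function.iterate_succ_apply']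
  exact Set.subset_biUnion_of_mem (u := fun k => ((i (r (Finsupp.single k 1))).support : Set I)) hn

/-- A module that is not finitely generated contains a countably generated such submodule. -/
theorem exists_countable_not_fg (N : Submodule R P) (hN : ¬ N.FG) :
    ∃ A : Set P, A.Countable ∧ A ⊆ N ∧ ¬ (Submodule.span R A).FG := by
  classical
  obtain ⟨K, hK, hlt⟩ := exists_seq_of_forall_finset_exists
    (fun K : Submodule R P => K.FG ∧ K ≤ N) (fun K L => K < L) (by
      intro s hs
      have h1 : (s.sup id).FG := Submodule.fg_finset_sup s id fun K hK => (hs K hK).1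
      have h2 : s.sup id ≤ N := Finset.sup_le fun K hK => (hs K hK).2
      have h3 : ∃ y ∈ N, y ∉ s.sup id := by
        by_contra hcon
        push Not at hcon
        exact hN (le_antisymm h2 hcon ▸ h1)
      obtain ⟨y, hy, hy'⟩ := h3
      refine ⟨s.sup id ⊔ Submodule.span R {y}, ⟨h1.sup (Submodule.fg_span_singleton y),
        sup_le h2 (by simpa using hy)⟩, fun K hK => ?_⟩
      refine lt_of_le_of_lt (Finset.le_sup (f := id) hK)
        (lt_of_le_of_ne le_sup_left fun h => hy' ?_)
      have : y ∈ s.sup id ⊔ Submodule.span R {y} :=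
        Submodule.mem_sup_right (Submodule.mem_span_singleton_self y)
      rwa [← h] at this)
  have hg : ∀ n, ∃ t : Finset P, Submodule.span R (t : Set P) = K n := fun n => (hK n).1
  choose t ht using hg
  refine ⟨⋃ n, (t n : Set P), Set.countable_iUnion fun n => Finset.countable_toSet _, ?_, ?_⟩
  · refine Set.iUnion_subset fun n x hx => (hK n).2 ?_
    rw [← ht n]
    exact Submodule.subset_span hx
  · intro hfg
    have hmono : StrictMono K := fun m n h => hlt m n h
    have hsup : iSup K = Submodule.span R (⋃ n, (t n : Set P)) := by
      rw [Submodule.span_iUnion]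
      exact iSup_congr fun n => (ht n).symm
    obtain ⟨n, hn⟩ := Submodule.FG.stabilizes_of_iSup_eq hfg ⟨K, hmono.monotone⟩ hsup
    have h1 : K (n + 1) ≤ K n := by
      refine (le_iSup K (n + 1)).trans ?_
      rw [hsup, hn]
      rfl
    exact absurd (hmono (Nat.lt_succ_self n)) (not_lt_of_ge h1)

/-- The extension step. -/
theorem extend [IsNoetherianRing R] [ConnectedSpace (PrimeSpectrum R)] [Module.Projective R P]
    (hri : ∀ x, r (i x) = x) (S : Set I) (B : Set P) (hS : Good i r S)
    (hB : LinearIndepOn R id B) (hBS : Submodule.span R B = part r S)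
    (ρ : P →ₗ[R] P) (hρ : ∀ x, ρ x ∈ part r S) (hρ' : ∀ x ∈ part r S, ρ x = x)
    (hfg : ¬ (LinearMap.ker ρ).FG) :
    ∃ T B', Good i r T ∧ LinearIndepOn R id B' ∧ Submodule.span R B' = part r T ∧
      S ⊆ T ∧ B ⊆ B' ∧ ¬ part r T ≤ part r S := by
  classical
  obtain ⟨A, hA, hAN, hAfg⟩ := exists_countable_not_fg _ hfg
  obtain ⟨C, hAC, hC, hCg⟩ := exists_good_countable i r
    (⋃ x ∈ A, ((i x).support : Set I)) (hA.biUnion fun x _ => Finset.countable_toSet _)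
  have hT := hS.union i r hCg
  obtain ⟨ρ', h1, h2⟩ := hT.retract i r hri
  have hST : part r S ≤ part r (S ∪ C) := part_mono r Set.subset_union_left
  let N : Submodule R P := LinearMap.ker ρ ⊓ part r (S ∪ C)
  have hρρ : ∀ x, ρ (ρ x) = ρ x := fun x => hρ' _ (hρ x)
  have hAle : Submodule.span R A ≤ N := by
    rw [Submodule.span_le]
    intro x hx
    refine ⟨hAN hx, mem_part i r hri ?_⟩
    exact (Set.subset_biUnion_of_mem (u := fun x => ((i x).support : Set I)) hx).trans
      (hAC.trans Set.subset_union_right)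
  have hτ : ∀ x, ρ' x - ρ (ρ' x) ∈ N := fun x =>
    ⟨by simp [LinearMap.mem_ker, hρρ], Submodule.sub_mem _ (h1 x) (hST (hρ _))⟩
  let τ : P →ₗ[R] N := (ρ' - ρ ∘ₗ ρ').codRestrict N hτ
  have hτid : ∀ x : N, τ x = x := by
    rintro ⟨x, hx1, hx2⟩
    apply Subtype.ext
    have : ρ x = 0 := hx1
    simp [τ, h2 x hx2, this]
  have hτsurj : Function.Surjective τ := fun x => ⟨x, hτid x⟩
  have : Module.Projective R N := Module.Projective.of_split N.subtype τ
    (LinearMap.ext fun x => hτid x)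
  have hNfin : ¬ Module.Finite R N := by
    intro hf
    apply hAfg
    have hNn : IsNoetherian R N := isNoetherian_of_isNoetherianRing_of_finite R N
    exact isNoetherian_submodule.1 hNn _ hAle
  have hNspan : Submodule.span R ((fun k => τ (r (Finsupp.single k 1))) '' C) = ⊤ := by
    rw [eq_top_iff]
    have h3 : (part r (S ∪ C)).map τ ≤
        Submodule.span R ((fun k => τ (r (Finsupp.single k 1))) '' C) := by
      rw [part_eq_span, Submodule.map_span, Submodule.span_le]
      rintro _ ⟨_, ⟨k, hk, rfl⟩, rfl⟩
      rcases hk with hk | hk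
      · have hk' : r (Finsupp.single k 1) ∈ part r S := by
          rw [part_eq_span]; exact Submodule.subset_span ⟨k, hk, rfl⟩
        have : τ (r (Finsupp.single k 1)) = 0 := by
          apply Subtype.ext
          simp [τ, h2 _ (hST hk'), hρ' _ hk']
        simp only [SetLike.mem_coe]
        rw [this]; exact Submodule.zero_mem _
      · exact Submodule.subset_span ⟨k, hk, rfl⟩
    intro x _
    exact h3 ⟨x, x.2.2, hτid x⟩
  obtain ⟨u, hu⟩ : ∃ u : ℕ → N, Submodule.span R (Set.range u) = ⊤ := by
    have hne : C.Nonempty := by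
      by_contra hne
      rw [Set.not_nonempty_iff_eq_empty] at hne
      subst hne
      apply hNfin
      rw [Module.finite_def, ← hNspan]
      simpa using Submodule.fg_bot
    obtain ⟨f, hf⟩ := (hC.image fun k => τ (r (Finsupp.single k 1))).exists_eq_range (hne.image _)
    exact ⟨f, by rw [← hf, hNspan]⟩
  have hfree : Module.Free R N := free_of_countable hNfin u hu
  let b := Module.Free.chooseBasis R N
  let D : Set P := Set.range fun k => (b k : P)
  have hD : Submodule.span R D = N := by
    have : D = N.subtype '' Set.range b := by rw [← Set.range_comp]; rfl
    rw [this, Submodule.span_image, b.span_eq, Submodule.map_top, Submodule.range_subtype]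
  have hDind : LinearIndepOn R id D := by
    have : LinearIndependent R (fun k => (b k : P)) :=
      b.linearIndependent.map' N.subtype (Submodule.ker_subtype N)
    exact this.linearIndepOn_id
  refine ⟨S ∪ C, B ∪ D, hT, hB.id_union hDind ?_, ?_, Set.subset_union_left,
    Set.subset_union_left, ?_⟩
  · rw [hBS, hD, Submodule.disjoint_def]
    intro x hx hx'
    rw [← hρ' x hx]
    exact hx'.1
  · rw [Submodule.span_union, hBS, hD]
    refine le_antisymm (sup_le hST inf_le_right) fun x hx => ?_
    have : x = ρ x + (ρ' x - ρ (ρ' x)) := by rw [h2 x hx]; abel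
    rw [this]
    exact Submodule.add_mem_sup (hρ x) (hτ x)
  · intro hle
    apply hNfin
    have : N = ⊥ := by
      rw [eq_bot_iff]
      intro x hx
      rw [Submodule.mem_bot, ← hρ' x (hle hx.2)]
      exact hx.1
    rw [this]
    infer_instance

end big
end BassAux

/-- Bass: over a commutative Noetherian ring with connected spectrum, every
infinitely generated projective module is free. -/
theorem bass_infinitely_generated_projective_free
    (R : Type*) [CommRing R] [IsNoetherianRing R]
    [ConnectedSpace (PrimeSpectrum R)]
    (P : Type*) [AddCommGroup P] [Module R P]
    (hproj : Module.Projective R P) (hinf : ¬ Module.Finite R P) :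
    Module.Free R P := by
  classical
  obtain ⟨i, hs⟩ := Module.projective_def'.1 hproj
  have hri : ∀ x, Finsupp.linearCombination R id (i x) = x := fun x => LinearMap.congr_fun hs x
  generalize Finsupp.linearCombination R (id : P → P) = r at hs hri
  let Z : Set (Set P × Set P) := {p | BassAux.Good i r p.1 ∧ LinearIndepOn R id p.2 ∧
    Submodule.span R p.2 = BassAux.part r p.1}
  obtain ⟨⟨S, B⟩, hmax⟩ := zorn_le₀ Z (by
    intro c hc hch
    refine ⟨(⋃₀ (Prod.fst '' c), ⋃₀ (Prod.snd '' c)), ⟨?_, ?_, ?_⟩, ?_⟩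
    · refine BassAux.Good.sUnion i r ?_
      rintro _ ⟨p, hp, rfl⟩
      exact (hc hp).1
    · refine linearIndepOn_sUnion_of_directed ?_ ?_
      · rintro _ ⟨p, hp, rfl⟩ _ ⟨q, hq, rfl⟩
        rcases hch.total hp hq with h | h
        · exact ⟨q.2, ⟨q, hq, rfl⟩, h.2, subset_rfl⟩
        · exact ⟨p.2, ⟨p, hp, rfl⟩, subset_rfl, h.2⟩
      · rintro _ ⟨p, hp, rfl⟩
        exact (hc hp).2.1
    · rw [BassAux.part_eq_span]
      simp only [Set.sUnion_image, Set.image_iUnion, Submodule.span_iUnion]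
      refine iSup_congr fun p => iSup_congr fun hp => ?_
      rw [(hc hp).2.2, BassAux.part_eq_span]
    · intro p hp
      exact ⟨Set.subset_sUnion_of_mem ⟨p, hp, rfl⟩, Set.subset_sUnion_of_mem ⟨p, hp, rfl⟩⟩)
  obtain ⟨hS, hB, hBS⟩ := hmax.prop
  simp only at hS hB hBS
  obtain ⟨ρ, h1, h2⟩ := hS.retract i r hri
  have hfg : (LinearMap.ker ρ).FG := by
    by_contra hfg
    obtain ⟨T, B', hT, hB', hBT, hST, hBB, hlt⟩ :=
      BassAux.extend i r hri S B hS hB hBS ρ h1 h2 hfg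
    have := hmax.le_of_ge (y := (T, B')) ⟨hT, hB', hBT⟩ ⟨hST, hBB⟩
    exact hlt (BassAux.part_mono r this.1)
  let M := BassAux.part r S
  let g : P →ₗ[R] M := ρ.codRestrict M h1
  have hker : LinearMap.ker g = LinearMap.ker ρ := LinearMap.ker_codRestrict _ _ _
  obtain ⟨e⟩ := BassAux.split_equiv M.subtype g (fun a => Subtype.ext (h2 a a.2))
  have hQfin : Module.Finite R (LinearMap.ker g) := by
    rw [hker]; exact Module.Finite.iff_fg.2 hfg
  have hQproj : Module.Projective R (LinearMap.ker g) :=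
    Module.Projective.of_split (e.symm.toLinearMap ∘ₗ LinearMap.inr R _ _)
      (LinearMap.snd R _ _ ∘ₗ e.toLinearMap) (by ext x; simp)
  let b : (B →₀ R) ≃ₗ[R] M := by
    have b0 : Module.Basis B R (Submodule.span R (Set.range ((↑) : B → P))) :=
      Module.Basis.span (v := ((↑) : B → P)) hB
    refine b0.repr.symm.trans (LinearEquiv.ofEq _ _ ?_)
    rw [Subtype.range_coe, hBS]
  have hBinf : Infinite B := by
    by_contra hfinB
    rw [not_infinite_iff_finite] at hfinB
    apply hinf
    have : Module.Finite R M := Module.Finite.equiv b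
    exact Module.Finite.equiv e.symm
  obtain ⟨d⟩ : Nonempty (ℕ ⊕ B ≃ B) := by
    rw [← Cardinal.eq, Cardinal.mk_sum]
    simpa using Cardinal.add_eq_right (Cardinal.aleph0_le_mk B) (Cardinal.aleph0_le_mk B)
  obtain ⟨u, hu⟩ : ∃ u : ℕ → LinearMap.ker g, Submodule.span R (Set.range u) = ⊤ := by
    obtain ⟨t, ht⟩ := hQfin.fg_top
    obtain ⟨f, hf⟩ := (t.countable_toSet.insert 0).exists_eq_range (Set.insert_nonempty _ _)
    exact ⟨f, by rw [← hf, Submodule.span_insert_zero, ht]⟩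
  obtain ⟨a⟩ := BassAux.absorb (R := R) u hu
  let eB : (B →₀ R) ≃ₗ[R] (ℕ →₀ R) × (B →₀ R) :=
    (Finsupp.domLCongr d.symm).trans (Finsupp.sumFinsuppLEquivProdFinsupp R)
  let E : P ≃ₗ[R] (B →₀ R) :=
    ((e.trans (LinearEquiv.prodComm R _ _)).trans
      ((LinearEquiv.refl R _).prodCongr (b.symm.trans eB))).trans
      (((LinearEquiv.prodAssoc R _ _ _).symm.trans
        (a.prodCongr (LinearEquiv.refl R _))).trans eB.symm)
  exact Module.Free.of_equiv E.symm
end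

section
/- Let R be a Henselian local commutative ring, P an R-module, F ⊆ P a finitely generated submodule, and π ∈ End_R(P) an endomorphism with im(π² − π) ⊆ F. Then there exists an idempotent endomorphism π̃ ∈ End_R(P) (i.e., π̃² = π̃) with im(π̃ − π) ⊆ F. -/
open Polynomial IsLocalRing

theorem henselian_section {R : Type*} [CommRing R] [HenselianLocalRing R]
    {S : Type*} [CommRing S] [Algebra R S] [Algebra.Etale R S]
    {K : Type*} [Field K] [Algebra R K] (hK : Function.Surjective (algebraMap R K))
    (ψ : S →ₐ[R] K) : ∃ φ : S →ₐ[R] R, (Algebra.ofId R K).comp φ = ψ := by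
  have hQ : (RingHom.ker ψ.toRingHom).IsPrime := RingHom.ker_isPrime _
  obtain ⟨s, hs, H⟩ := Algebra.IsUnramifiedAt.exists_hasStandardEtaleSurjectionOn (R := R)
    (RingHom.ker ψ.toRingHom)
  have hs' : IsUnit (ψ s) := by
    rw [isUnit_iff_ne_zero]
    exact fun h => hs h
  have : Algebra.Etale R (Localization.Away s) := by
    have : Algebra.Etale S (Localization.Away s) := Algebra.Etale.of_isLocalizationAway s
    exact Algebra.Etale.comp R S _
  have hst := H.isStandardEtale
  let P : StandardEtalePresentation R (Localization.Away s) := Nonempty.some inferInstance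
  let ψ' : Localization.Away s →ₐ[R] K := IsLocalization.Away.liftAlgHom (f := ψ) s hs'
  have hψ' : ∀ x, ψ' (algebraMap S _ x) = ψ x := fun x => by simp [ψ']
  let θ : P.Ring →ₐ[R] K := ψ'.comp P.equivRing.symm.toAlgHom
  have hx := StandardEtalePair.hasMap_X.map θ
  obtain ⟨a₀, ha₀⟩ := hK (θ P.X)
  have hker := ker_eq_maximalIdeal (algebraMap R K) hK
  have hunit : ∀ r : R, algebraMap R K r ≠ 0 → IsUnit r := by
    intro r hr
    by_contra h
    exact hr (hker.ge ((mem_maximalIdeal r).2 h))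
  obtain ⟨a, ha, haa⟩ := HenselianLocalRing.is_henselian P.f P.monic_f a₀
    (by
      rw [← hker, RingHom.mem_ker]
      have := hx.1
      rwa [← ha₀, aeval_algebraMap_apply, coe_aeval_eq_eval] at this)
    (by
      apply hunit
      have := hx.isUnit_derivative_f.ne_zero
      rwa [← ha₀, aeval_algebraMap_apply, coe_aeval_eq_eval] at this)
  have haK : algebraMap R K a = θ P.X := by
    rw [← hker, RingHom.mem_ker, map_sub, sub_eq_zero] at haa
    rw [haa, ha₀]
  have hmap : P.HasMap a := by
    refine ⟨by simpa using ha, hunit _ ?_⟩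
    have := hx.2.ne_zero
    rwa [← haK, aeval_algebraMap_apply] at this
  let lf := P.lift a hmap
  have hlf : (Algebra.ofId R K).comp lf = θ := by
    apply StandardEtalePair.hom_ext
    simpa [lf, Algebra.ofId_apply] using haK
  refine ⟨(lf.comp P.equivRing.toAlgHom).comp (IsScalarTower.toAlgHom R S _), ?_⟩
  ext x
  have := DFunLike.congr_fun hlf (P.equivRing (algebraMap S _ x))
  simpa [θ, hψ'] using this

theorem henselian_idem_poly {R : Type*} [CommRing R] [HenselianLocalRing R]
    (f : R[X]) (hf : f.Monic) (h0 : f.eval 0 = 0) (h1 : f.eval 1 = 0) :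
    ∃ e : R[X], f ∣ e * e - e ∧ e.eval 0 = 0 ∧ e.eval 1 = 1 := by
  let m := maximalIdeal R
  let κ := m.ResidueField
  obtain ⟨b, hb, hb'⟩ := exists_eq_pow_rootMultiplicity_mul_and_not_dvd
      (f.map (algebraMap R κ)) (hf.map _).ne_zero 0
  set n := rootMultiplicity 0 (f.map (algebraMap R κ)) with hn
  have hn0 : n ≠ 0 := by
    have : 0 < n := by
      rw [hn, rootMultiplicity_pos (hf.map _).ne_zero]
      have := eval_map_apply (algebraMap R κ) (p := f) 0
      simpa [h0, IsRoot] using this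
    omega
  rw [C_0, sub_zero] at hb hb'
  have hbm : b.Monic := by
    simpa [(hf.map _).leadingCoeff] using! congr(leadingCoeff $hb).symm
  have hcop : IsCoprime (X ^ n) b := by
    apply IsCoprime.pow_left
    exact (prime_X (R := κ)).irreducible.coprime_iff_not_dvd.2 hb'
  obtain ⟨S, _, _, _, Q, _, _, a', b', hP, ha'm, hb'm, hfab', hc, ha', hb'⟩ :=
    Algebra.exists_etale_bijective_residueFieldMap_and_map_eq_mul_and_isCoprime m f
      (X ^ n) b hf (monic_X.pow _) hbm hb hcop
  have hsurj : Function.Surjective (algebraMap R Q.ResidueField) := by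
    intro y
    obtain ⟨z, rfl⟩ := hP.2 y
    obtain ⟨r, rfl⟩ := Ideal.algebraMap_residueField_surjective m z
    exact ⟨r, by simp⟩
  have hker := ker_eq_maximalIdeal (algebraMap R Q.ResidueField) hsurj
  obtain ⟨φ, hφ⟩ := henselian_section hsurj (IsScalarTower.toAlgHom R S Q.ResidueField)
  have hφ' : ∀ x, algebraMap R Q.ResidueField (φ x) = algebraMap S Q.ResidueField x :=
    fun x => DFunLike.congr_fun hφ x
  have hφ'' : (algebraMap R Q.ResidueField).comp φ.toRingHom = algebraMap S Q.ResidueField :=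
    RingHom.ext hφ'
  obtain ⟨c, d, hcd⟩ := hc.map (mapRingHom φ.toRingHom)
  set F := mapRingHom φ.toRingHom a' with hF
  set G := mapRingHom φ.toRingHom b' with hG
  have hFG : f = F * G := by
    rw [hF, hG, ← map_mul, ← hfab']
    simp only [coe_mapRingHom, Polynomial.map_map]
    rw [show φ.toRingHom.comp (algebraMap R S) = RingHom.id R from RingHom.ext fun r => by simp]
    simp
  have hFm : F.map (algebraMap R Q.ResidueField) = X ^ n := by
    rw [hF, coe_mapRingHom, Polynomial.map_map, hφ'', ← ha']
    simp
  have hFev : ∀ r : R, algebraMap R Q.ResidueField (F.eval r) = (algebraMap R _ r) ^ n := by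
    intro r
    rw [← eval_map_apply, hFm]; simp
  have idem : ∀ r : R, r * r - r = 0 → algebraMap R Q.ResidueField r = 0 → r = 0 := by
    intro r hr hr0
    have h2 : IsUnit (1 - r) := by
      by_contra h
      have h3 : algebraMap R Q.ResidueField (1 - r) = 0 := hker.ge ((mem_maximalIdeal _).2 h)
      rw [map_sub, hr0] at h3
      simp at h3
    apply (h2.mul_right_eq_zero).1
    linear_combination -hr
  have hdvd : c * F * (c * F) - c * F = - (c * d) * f := by
    rw [hFG]; linear_combination (c * F) * hcd
  have hev : ∀ r, f.eval r = 0 → (c * F).eval r * (c * F).eval r - (c * F).eval r = 0 := by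
    intro r hr
    have := congr(eval r $hdvd)
    simpa [hr] using this
  refine ⟨c * F, ⟨- (c * d), by rw [hdvd]; ring⟩, ?_, ?_⟩
  · apply idem _ (hev 0 h0)
    rw [eval_mul, map_mul, hFev]; simp [hn0]
  · have hG1 : algebraMap R Q.ResidueField (G.eval 1) = 0 := by
      have := congr(algebraMap R Q.ResidueField (eval 1 $hFG))
      rw [h1, eval_mul, map_mul, hFev] at this
      simpa using this.symm
    have h2 := congr(eval 1 $hcd)
    rw [eval_add, eval_mul (p := d), eval_one] at h2
    have := idem (1 - (c * F).eval 1) (by linear_combination hev 1 h1) (by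
      rw [show 1 - (c * F).eval 1 = d.eval 1 * G.eval 1 by linear_combination -h2, map_mul, hG1,
        mul_zero])
    linear_combination -this

/-- Drinfeld's key lemma: over a Henselian local ring, an endomorphism which
is idempotent modulo a finitely generated submodule `F` can be corrected by
a map with image in `F` to an actual idempotent. -/
theorem exists_idempotent_approx_henselian
    (R : Type*) [CommRing R] [HenselianLocalRing R]
    (P : Type*) [AddCommGroup P] [Module R P]
    (F : Submodule R P) (hF : F.FG)
    (π : P →ₗ[R] P) (h : LinearMap.range (π ∘ₗ π - π) ≤ F) :
    ∃ π' : P →ₗ[R] P, π' ∘ₗ π' = π' ∧ LinearMap.range (π' - π) ≤ F := by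
  have hE : ∀ x, π (π x) - π x ∈ F := fun x => h ⟨x, by simp⟩
  let F' := F ⊔ F.map π
  have hF' : F'.FG := hF.sup (hF.map π)
  have hst : ∀ x ∈ F', π x ∈ F' := by
    intro x hx
    obtain ⟨y, hy, z, ⟨w, hw, rfl⟩, rfl⟩ := Submodule.mem_sup.1 hx
    rw [map_add]
    refine add_mem (Submodule.mem_sup_right ⟨y, hy, rfl⟩) ?_
    have h1 : π (π w) = (π (π w) - π w) + π w := by abel
    rw [h1]
    exact add_mem (Submodule.mem_sup_left (hE w)) (Submodule.mem_sup_right ⟨w, hw, rfl⟩)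
  have : Module.Finite R F' := Module.Finite.iff_fg.2 hF'
  obtain ⟨p, hp, hp0⟩ := LinearMap.exists_monic_and_aeval_eq_zero R (π.restrict hst)
  have hpF : ∀ x ∈ F', aeval π p x = 0 := by
    intro x hx
    have h1 : (aeval π p) x = ((aeval (π.restrict hst) p) ⟨x, hx⟩ : F') := by
      have key : ∀ q : R[X], (aeval π q) x = ((aeval (π.restrict hst) q) ⟨x, hx⟩ : F') := by
        intro q
        induction q using Polynomial.induction_on with
        | C a => simp
        | add p q hp hq => simp [hp, hq]
        | monomial n a ih =>
          rw [pow_succ', mul_left_comm, map_mul _ X, map_mul _ X, Module.End.mul_apply, ih,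
            Module.End.mul_apply, aeval_X, aeval_X, LinearMap.restrict_coe_apply]
      exact key p
    rw [h1, hp0]; simp
  have hf : (X * (X - 1) * p : R[X]).Monic :=
    (monic_X.mul (by simpa using monic_X_sub_C (1 : R))).mul hp
  obtain ⟨e, ⟨u, hu⟩, he0, he1⟩ := henselian_idem_poly (X * (X - 1) * p) hf (by simp) (by simp)
  obtain ⟨v, hv⟩ : (X * (X - 1) : R[X]) ∣ e - X := by
    refine IsCoprime.mul_dvd ⟨1, -1, by ring⟩ ?_ ?_
    · rw [X_dvd_iff, coeff_zero_eq_eval_zero]; simp [he0]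
    · rw [← C_1, dvd_iff_isRoot]; simp [he1]
  have hzero : aeval π (X * (X - 1) * p) = 0 := by
    rw [mul_comm, map_mul]
    ext x
    rw [Module.End.mul_apply]
    apply hpF
    apply Submodule.mem_sup_left
    simpa using hE x
  refine ⟨aeval π e, ?_, ?_⟩
  · have := congr(aeval π $hu)
    rw [map_mul _ _ u, hzero, zero_mul, map_sub, map_mul, sub_eq_zero] at this
    exact this
  · rintro _ ⟨x, rfl⟩
    have : aeval π e - π = aeval π (X * (X - 1) * v) := by rw [← hv]; simp
    rw [this, map_mul, Module.End.mul_apply]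
    simpa using hE (aeval π v x)
end
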